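/- V(3,6) = (1/3) · max_{x∈[0,1/2]} A(√3/2, x); that is, the supremum of the volumes of convex hulls of 6-point sets of diameter at most 1 in ℝ³ equals one third of the maximum of A(√3/2, x) over x ∈ [0, 1/2]. -/

import Mathlib

open MeasureTheory Metric Set

/-- `polyVol n k` is the supremum, over all sets `S` of `k` points in Euclidean `n`-space
whose diameter is at most 1, of the `n`-dimensional Lebesgue measure of the convex hull
of `S`. -/
noncomputable def polyVol (n k : ℕ) : ℝ :=
  sSup {v : ℝ | ∃ S : Finset (EuclideanSpace ℝ (Fin n)),
    S.card = k ∧ Metric.diam (S : Set (EuclideanSpace ℝ (Fin n))) ≤ 1 ∧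
    v = (volume (convexHull ℝ (S : Set (EuclideanSpace ℝ (Fin n))))).toReal}

/-- `A r x = (1/2)·x·√(3 − 4x − 4x²) + (1/2)·√(r² − x²)`. -/
noncomputable def A (r x : ℝ) : ℝ :=
  1 / 2 * x * Real.sqrt (3 - 4 * x - 4 * x ^ 2) + 1 / 2 * Real.sqrt (r ^ 2 - x ^ 2)

/-! ### Planar inequality -/

lemma A_two (x : ℝ) : 2 * A (Real.sqrt 3 / 2) x =
    2 * x * Real.sqrt (3 / 4 - x - x ^ 2) + Real.sqrt (3 / 4 - x ^ 2) := by
  have h1 : (3 - 4 * x - 4 * x ^ 2) = 2 ^ 2 * (3 / 4 - x - x ^ 2) := by ring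
  have h2 : ((Real.sqrt 3 / 2) ^ 2 - x ^ 2) = 3 / 4 - x ^ 2 := by
    rw [div_pow, Real.sq_sqrt (by norm_num)]; norm_num
  unfold A
  rw [h1, h2, Real.sqrt_mul (by norm_num), Real.sqrt_sq (by norm_num)]
  ring

set_option maxHeartbeats 2000000 in
lemma core_small (x X d h Q P B : ℝ) (hx0 : 0 ≤ x) (hx1 : x ≤ 1 / 2) (hX : 0 ≤ X) (hd : 0 ≤ d)
    (hP : 0 ≤ P) (hQ : 0 ≤ Q) (h1 : (x + P) ^ 2 + Q ^ 2 ≤ 3 / 4)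
    (h2 : (x + X / 2) ^ 2 + h ^ 2 + d ^ 2 / 4 ≤ 1) (h3 : X ^ 2 + d ^ 2 ≤ 1)
    (hB : (293 / 250) ≤ B) (hA : 2 * x * Real.sqrt (3 / 4 - x - x ^ 2) + Real.sqrt (3 / 4 - x ^ 2) ≤ B)
    (hc : d * Real.sqrt (3 / 4 - x ^ 2) ≤ x * X) :
    2 * x * h + Q * X + P * d ≤ B := by
  obtain ⟨q, hq⟩ : ∃ q, q = Real.sqrt (3 / 4 - x ^ 2) := ⟨_, rfl⟩
  have hqq : q ^ 2 = 3 / 4 - x ^ 2 := by rw [hq, Real.sq_sqrt]; nlinarith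
  have hq0 : 0 ≤ q := hq ▸ Real.sqrt_nonneg _
  have hq7 : (7 / 10) ≤ q := by nlinarith
  have hX1 : X ≤ 1 := by nlinarith
  rw [← hq] at hA hc
  -- Q X + P d ≤ q X
  have k1 : Q * X + P * d ≤ q * X := by
    have : Q * q + (x + P) * x ≤ 3 / 4 := by nlinarith [sq_nonneg (Q - q), sq_nonneg P]
    have e1 : q * (Q * X + P * d) ≤ q * (q * X) := by
      have : X * (Q * q) ≤ X * (q ^ 2 - P * x) := mul_le_mul_of_nonneg_left (by nlinarith) hX
      nlinarith [mul_le_mul_of_nonneg_left hc hP]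
    exact le_of_mul_le_mul_left e1 (by linarith)
  have h4 : (x + X / 2) ^ 2 + h ^ 2 ≤ 1 := by nlinarith [sq_nonneg d]
  rcases le_total x (37 / 100) with hx | hx
  · obtain ⟨g, hg⟩ : ∃ g, g = Real.sqrt (3 / 4 - x - x ^ 2) := ⟨_, rfl⟩
    have hgg : g ^ 2 = 3 / 4 - x - x ^ 2 := by rw [hg, Real.sq_sqrt]; nlinarith
    have hg0 : 0 ≤ g := hg ▸ Real.sqrt_nonneg _
    have hgp : (2 / 5) ≤ g := by nlinarith
    rw [← hg] at hA
    have k2 : x * (x + 1 / 2) ≤ g * q := by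
      apply le_of_sq_le_sq _ (by positivity)
      rw [mul_pow g q, hgg, hqq]
      have e1 : x ^ 2 ≤ (37 / 100) ^ 2 := pow_le_pow_left₀ hx0 hx 2
      linarith [show (3 / 4 - x - x ^ 2) * (3 / 4 - x ^ 2) - (x * (x + 1 / 2)) ^ 2 =
        9 / 16 - 3 / 4 * x - 7 / 4 * x ^ 2 by ring]
    have k3 : 2 * g * (h - g) ≤ (1 - X) * (x + 1 / 2) := by
      have e1 := sq_nonneg (h - g)
      have e2 := sq_nonneg (1 - X)
      have e3 : 2 * g * (h - g) = h ^ 2 - g ^ 2 - (h - g) ^ 2 := by ring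
      have e4 : (1 - (x + X / 2) ^ 2) - (3 / 4 - x - x ^ 2) = (1 - X) * (x + 1 / 2) - (1 - X) ^ 2 / 4 := by
        ring
      linarith
    have k4 : 2 * x * (h - g) ≤ (1 - X) * q := by
      have : g * (2 * x * (h - g)) ≤ g * ((1 - X) * q) := by
        nlinarith [mul_le_mul_of_nonneg_left k3 hx0, mul_le_mul_of_nonneg_left k2 (sub_nonneg.2 hX1)]
      exact le_of_mul_le_mul_left this (by linarith)
    nlinarith
  · have k2 : x * h + q * (x + X / 2) ≤ (8661 / 10000) := by
      apply le_of_sq_le_sq _ (by norm_num)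
      nlinarith [sq_nonneg (x * (x + X / 2) - q * h), mul_le_mul_of_nonneg_left h4 (by positivity : 0 ≤ x^2 + q^2)]
    have k3 : (1401 / 5000) ≤ q * x := by
      apply le_of_sq_le_sq _ (by positivity)
      rw [mul_pow, hqq]
      nlinarith [mul_nonneg (sub_nonneg.2 hx) (sub_nonneg.2 hx1), mul_nonneg (mul_nonneg (sub_nonneg.2 hx) (sub_nonneg.2 hx1)) hx0]
    nlinarith

set_option maxHeartbeats 2000000 in
lemma core_large (x X d h Q P : ℝ) (hx0 : 0 ≤ x) (hx1 : x ≤ 1 / 2) (hX : 0 ≤ X) (hd : 0 ≤ d)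
    (h1 : (x + P) ^ 2 + Q ^ 2 ≤ 3 / 4)
    (h2 : (x + X / 2) ^ 2 + h ^ 2 + d ^ 2 / 4 ≤ 1) (h3 : X ^ 2 + d ^ 2 ≤ 1)
    (hc : x * X ≤ d * Real.sqrt (3 / 4 - x ^ 2)) :
    2 * x * h + Q * X + P * d ≤ (293 / 250) := by
  obtain ⟨q, hq⟩ : ∃ q, q = Real.sqrt (3 / 4 - x ^ 2) := ⟨_, rfl⟩
  have hqq : q ^ 2 = 3 / 4 - x ^ 2 := by rw [hq, Real.sq_sqrt]; nlinarith
  have hq0 : 0 ≤ q := hq ▸ Real.sqrt_nonneg _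
  have hq7 : q ≤ (8661 / 10000) := by nlinarith
  rw [← hq] at hc
  obtain ⟨e, he⟩ : ∃ e, e = Real.sqrt (X ^ 2 + d ^ 2) := ⟨_, rfl⟩
  have hee : e ^ 2 = X ^ 2 + d ^ 2 := by rw [he, Real.sq_sqrt]; positivity
  have he0 : 0 ≤ e := he ▸ Real.sqrt_nonneg _
  have he1 : e ≤ 1 := by nlinarith
  have k1 : (x + P) * d + Q * X ≤ (8661 / 10000) * e := by
    apply le_of_sq_le_sq _ (by positivity)
    have : ((x + P) ^ 2 + Q ^ 2) * e ^ 2 ≤ 3 / 4 * e ^ 2 := mul_le_mul_of_nonneg_right h1 (by positivity)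
    nlinarith [sq_nonneg ((x + P) * X - Q * d)]
  rcases le_total x (9 / 25) with hx | hx
  · have k2 : (5 / 2) * x * e ≤ x * X * (50 / 31) + d := by
      apply le_of_sq_le_sq _ (by positivity)
      have e1 : x * X ≤ (8661 / 10000) * d := by nlinarith
      have e2 : 0 ≤ x * X := by positivity
      have : ((5 / 2) * x * e) ^ 2 = (25 / 4) * x ^ 2 * (X ^ 2 + d ^ 2) := by rw [← hee]; ring
      rw [this]
      obtain ⟨y, hy⟩ : ∃ y, y = x * X := ⟨_, rfl⟩
      rw [← hy] at e1 e2 ⊢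
      rw [show (25 / 4) * x ^ 2 * (X ^ 2 + d ^ 2) = (25 / 4) * y ^ 2 + (25 / 4) * (x ^ 2 * d ^ 2) by rw [hy]; ring]
      have e4 : x ^ 2 * d ^ 2 ≤ (81 / 625) * d ^ 2 := by
        apply mul_le_mul_of_nonneg_right _ (sq_nonneg d); nlinarith
      have e5 := mul_nonneg e2 (sub_nonneg.2 e1)
      have e6 := sq_nonneg d
      have e7 := sq_nonneg y
      rw [show (y * (50 / 31) + d) ^ 2 = y ^ 2 * (2500 / 961) + y * d * (100 / 31) + d ^ 2 by ring]
      nlinarith only [e4, e5, e6, e7]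
    have k3 : 2 * x * h ≤ x * (h ^ 2 + (31 / 50) ^ 2) * (50 / 31) := by
      nlinarith only [mul_nonneg hx0 (sq_nonneg (h - (31 / 50)))]
    have k4 : x * h ^ 2 ≤ x * (1 - x ^ 2 - x * X - e ^ 2 / 4) := by
      apply mul_le_mul_of_nonneg_left _ hx0; nlinarith
    have k5 : 2 * x * h + Q * X + P * d ≤
        x * ((3461 / 2500) - x ^ 2) * (50 / 31) + ((8661 / 10000) - (5 / 2) * x ^ 2) * e - x * e ^ 2 * (25 / 62) := by
      have e1 := mul_le_mul_of_nonneg_left k2 hx0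
      linarith
    refine k5.trans ?_
    have k6 : 0 ≤ (1 - e) := by linarith
    have k7 : x * e ^ 2 ≥ x * (2 * e - 1) := by
      apply mul_le_mul_of_nonneg_left _ hx0; nlinarith
    have k8 : x * ((3461 / 2500) - x ^ 2) * (50 / 31) + ((8661 / 10000) - (5 / 2) * x ^ 2) * e - x * (2 * e - 1) * (25 / 62) ≤ (293 / 250) := by
      have a1 : x * ((3461 / 2500) - x ^ 2) * (50 / 31) + ((8661 / 10000) - (5 / 2) * x ^ 2) - x * (25 / 62) ≤ (293 / 250) := by
        nlinarith only [hx0, hx, mul_nonneg hx0 (sq_nonneg (x - (57 / 200))), sq_nonneg (x-(57 / 200))]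
      have a2 : x * ((3461 / 2500) - x ^ 2) * (50 / 31) + x * (25 / 62) ≤ (293 / 250) := by
        nlinarith only [hx0, hx, sq_nonneg (x - (9 / 25)), mul_nonneg hx0 (sq_nonneg (x - (9 / 25)))]
      nlinarith only [mul_nonneg k6 (sub_nonneg.2 a2), mul_nonneg he0 (sub_nonneg.2 a1)]
    linarith
  · have k2 : e ≤ x * X * (20 / 11) + d := by
      apply le_of_sq_le_sq _ (by positivity)
      have e1 : q ≤ (7877 / 10000) := by nlinarith
      have e2 : x * X ≤ (7877 / 10000) * d := by nlinarith
      have e3 : (9 / 25) * X ≤ x * X := by nlinarith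
      have e4 : (9 / 25) * X ≤ (7877 / 10000) * d := by linarith
      have e5 : (9 / 25) * X * X ≤ (7877 / 10000) * d * X := mul_le_mul_of_nonneg_right e4 hX
      rw [hee]
      nlinarith [mul_le_mul_of_nonneg_right e3 hd, mul_self_nonneg (x * X - (9 / 25) * X), mul_nonneg (sub_nonneg.2 e3) hX]
    have k3 : 2 * x * h ≤ x * (h ^ 2 + (11 / 20) ^ 2) * (20 / 11) := by
      nlinarith only [mul_nonneg hx0 (sq_nonneg (h - (11 / 20)))]
    have k4 : x * h ^ 2 ≤ x * (1 - x ^ 2 - x * X - e ^ 2 / 4) := by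
      apply mul_le_mul_of_nonneg_left _ hx0; nlinarith
    have k5 : 2 * x * h + Q * X + P * d ≤
        x * ((521 / 400) - x ^ 2) * (20 / 11) + ((8661 / 10000) - x) * e - x * e ^ 2 * (5 / 11) := by
      have e1 := mul_le_mul_of_nonneg_left k2 hx0
      linarith
    refine k5.trans ?_
    have k7 : x * e ^ 2 ≥ x * ((9 / 5) * e - (81 / 100)) := by
      apply mul_le_mul_of_nonneg_left _ hx0; nlinarith [sq_nonneg (e - (9 / 10))]
    have k8 : x * ((521 / 400) - x ^ 2) * (20 / 11) + ((8661 / 10000) - x) * e - x * ((9 / 5) * e - (81 / 100)) * (5 / 11) ≤ (293 / 250) := by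
      have a1 : x * ((521 / 400) - x ^ 2) * (20 / 11) + ((8661 / 10000) - x) - x * ((9 / 5) - (81 / 100)) * (5 / 11) ≤ (293 / 250) := by
        nlinarith only [hx1, hx, mul_nonneg hx0 (sq_nonneg (x - (21 / 50))), sq_nonneg (x-(21 / 50))]
      have a2 : x * ((521 / 400) - x ^ 2) * (20 / 11) + x * (81 / 100) * (5 / 11) ≤ (293 / 250) := by
        nlinarith only [hx1, hx, mul_nonneg hx0 (sq_nonneg (x - (1 / 2))), sq_nonneg (x-(1 / 2))]
      nlinarith only [mul_nonneg (sub_nonneg.2 he1) (sub_nonneg.2 a2), mul_nonneg he0 (sub_nonneg.2 a1)]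
    linarith

/-- The assumption on the bound used throughout. -/
def GoodB (B : ℝ) : Prop := 293 / 250 ≤ B ∧ ∀ x, 0 ≤ x → x ≤ 1 / 2 →
  2 * x * Real.sqrt (3 / 4 - x - x ^ 2) + Real.sqrt (3 / 4 - x ^ 2) ≤ B

set_option maxHeartbeats 1000000 in
lemma path_core (B t x mx Q X ey h : ℝ) (hB : GoodB B) (ht0 : 0 ≤ t) (ht1 : t ≤ 1)
    (hx0 : 0 ≤ x) (hx1 : x ≤ 1 / 2) (hQ : 0 ≤ Q)
    (hr : (x + |mx|) ^ 2 + Q ^ 2 ≤ 1 - t ^ 2 / 4)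
    (he : X ^ 2 + ey ^ 2 ≤ 1) (hh : h + |ey| / 2 ≤ 1)
    (hd : (x + X / 2) ^ 2 + h ^ 2 + ey ^ 2 / 4 ≤ 1) :
    t * (2 * x * h + Q * X + mx * ey) ≤ B := by
  obtain ⟨d, hdd⟩ : ∃ d, d = |ey| := ⟨_, rfl⟩
  obtain ⟨P, hPP⟩ : ∃ P, P = |mx| := ⟨_, rfl⟩
  have hd0 : 0 ≤ d := hdd ▸ abs_nonneg _
  have hP0 : 0 ≤ P := hPP ▸ abs_nonneg _
  have hd2 : ey ^ 2 = d ^ 2 := by rw [hdd, sq_abs]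
  have hm : mx * ey ≤ P * d := by rw [hPP, hdd, ← abs_mul]; exact le_abs_self _
  rw [← hdd] at hh
  rw [← hPP] at hr
  rw [hd2] at he hd
  have hs : (t * x + t * P) ^ 2 + (t * Q) ^ 2 ≤ 3 / 4 := by
    have h1 : t ^ 2 * ((x + P) ^ 2 + Q ^ 2) ≤ t ^ 2 * (1 - t ^ 2 / 4) :=
      mul_le_mul_of_nonneg_left hr (sq_nonneg t)
    have h2 : t ^ 2 ≤ 1 := by nlinarith
    have h3 : t ^ 2 * (1 - t ^ 2 / 4) ≤ 3 / 4 := by nlinarith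
    calc (t * x + t * P) ^ 2 + (t * Q) ^ 2 = t ^ 2 * ((x + P) ^ 2 + Q ^ 2) := by ring
      _ ≤ _ := h1.trans h3
  have htx : t * x ≤ x := by nlinarith
  have htx0 : 0 ≤ t * x := by positivity
  have htP : 0 ≤ t * P := by positivity
  have htQ : 0 ≤ t * Q := by positivity
  have main : 2 * (t * x) * h + (t * Q) * X + (t * P) * d ≤ B := by
    rcases le_total 0 X with hX | hX
    · have hd' : (t * x + X / 2) ^ 2 + h ^ 2 + d ^ 2 / 4 ≤ 1 := by
        have : (t * x + X / 2) ^ 2 ≤ (x + X / 2) ^ 2 :=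
          pow_le_pow_left₀ (by positivity) (by linarith) 2
        linarith
      rcases le_total (d * Real.sqrt (3 / 4 - (t * x) ^ 2)) ((t * x) * X) with hc | hc
      · exact core_small (t * x) X d h (t * Q) (t * P) B htx0 (by linarith) hX hd0 htP htQ hs hd' he
          hB.1 (hB.2 _ htx0 (by linarith)) hc
      · exact (core_large (t * x) X d h (t * Q) (t * P) htx0 (by linarith) hX hd0 hs hd' he
          hc).trans (by have := hB.1; linarith)
    · have h1 : t * x + t * P ≤ 8661 / 10000 := by
        apply le_of_sq_le_sq _ (by norm_num); nlinarith
      have h2 : 2 * (t * x) * h ≤ 2 * (t * x) * (1 - d / 2) :=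
        mul_le_mul_of_nonneg_left (by linarith) (by positivity)
      have h3 : t * Q * X ≤ 0 := mul_nonpos_of_nonneg_of_nonpos htQ hX
      have h4 : d ≤ 1 := by nlinarith
      have h5 : d * (t * x + t * P) ≤ d * (8661 / 10000) := mul_le_mul_of_nonneg_left h1 hd0
      have h6 : (1 - d) * (2 * (t * x)) ≤ (1 - d) * 1 :=
        mul_le_mul_of_nonneg_left (by linarith) (by linarith)
      have := hB.1
      nlinarith only [h2, h3, h4, h5, h6, this, hd0]
  have := mul_le_mul_of_nonneg_left hm ht0
  linarith

set_option maxHeartbeats 1000000 in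
lemma path_bound1 (B t z2 z3 p1 p2 p3 p4 q1 q q4 : ℝ) (hB : GoodB B) (ht : 0 ≤ t) (ht1 : t ^ 2 ≤ 1)
    (ha2 : z2 ^ 2 + p2 ^ 2 + q ^ 2 ≤ 1) (hb2 : (z2 - t) ^ 2 + p2 ^ 2 + q ^ 2 ≤ 1)
    (ha3 : z3 ^ 2 + p3 ^ 2 + q ^ 2 ≤ 1) (hb3 : (z3 - t) ^ 2 + p3 ^ 2 + q ^ 2 ≤ 1)
    (h13 : (p1 - p3) ^ 2 + (q1 - q) ^ 2 ≤ 1) (h24 : (p2 - p4) ^ 2 + (q - q4) ^ 2 ≤ 1)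
    (h14 : (p1 - p4) ^ 2 + (q1 - q4) ^ 2 ≤ 1) (h23 : (p2 - p3) ^ 2 ≤ 1)
    (hx : p2 ≤ p3) (hs : q * (p2 - p3) ≥ 0) :
    t * ((p1 * q - q1 * p2) + (p2 * q - q * p3) + (p3 * q4 - q * p4)) ≤ B := by
  have ht1' : t ≤ 1 := by nlinarith
  have hr2 : p2 ^ 2 + q ^ 2 ≤ 1 - t ^ 2 / 4 := by nlinarith [sq_nonneg (z2 - t / 2)]
  have hr3 : p3 ^ 2 + q ^ 2 ≤ 1 - t ^ 2 / 4 := by nlinarith [sq_nonneg (z3 - t / 2)]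
  rcases hx.eq_or_lt with hx | hx
  · subst hx
    have h1 : (p2 * (q4 - q1) + q * (p1 - p4)) ^ 2 ≤ 1 - t ^ 2 / 4 := by
      have := mul_le_mul hr2 h14 (by positivity) (by nlinarith)
      nlinarith [sq_nonneg (p2 * (p1 - p4) - q * (q4 - q1))]
    have h2 : t * (p2 * (q4 - q1) + q * (p1 - p4)) ≤ 1 := by
      apply le_of_sq_le_sq _ (by norm_num)
      rw [mul_pow]
      nlinarith [mul_le_mul_of_nonneg_left h1 (sq_nonneg t), sq_nonneg (t^2)]
    have := hB.1
    nlinarith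
  · have hq : q ≤ 0 := by
      by_contra hq
      push Not at hq
      nlinarith
    have := path_core B t ((p3 - p2) / 2) ((p2 + p3) / 2) (-q) (p4 - p1) (q4 - q1) ((q1 + q4) / 2 - q)
      hB ht ht1' (by linarith) (by nlinarith) (by linarith) ?_ (by nlinarith) ?_ ?_
    · refine le_of_eq_of_le ?_ this
      ring
    · rcases abs_cases ((p2 + p3) / 2) with ⟨h, _⟩ | ⟨h, _⟩ <;> rw [h]
      · refine le_of_eq_of_le ?_ hr3; ring
      · refine le_of_eq_of_le ?_ hr2; ring
    · rcases abs_cases (q4 - q1) with ⟨h, _⟩ | ⟨h, _⟩ <;> rw [h]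
      · nlinarith [sq_nonneg (p2 - p4)]
      · nlinarith [sq_nonneg (p1 - p3)]
    · nlinarith [sq_nonneg ((p3 - p1) - (p4 - p2)), sq_nonneg ((q - q1) - (q4 - q)),
        sq_nonneg ((p3 - p1) + (p4 - p2)), sq_nonneg ((q - q1) + (q4 - q))]

lemma path_bound2 (B t z2 z3 p1 p2 p3 p4 q1 q q4 : ℝ) (hB : GoodB B) (ht1 : t ^ 2 ≤ 1)
    (ha2 : z2 ^ 2 + p2 ^ 2 + q ^ 2 ≤ 1) (hb2 : (z2 - t) ^ 2 + p2 ^ 2 + q ^ 2 ≤ 1)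
    (ha3 : z3 ^ 2 + p3 ^ 2 + q ^ 2 ≤ 1) (hb3 : (z3 - t) ^ 2 + p3 ^ 2 + q ^ 2 ≤ 1)
    (h13 : (p1 - p3) ^ 2 + (q1 - q) ^ 2 ≤ 1) (h24 : (p2 - p4) ^ 2 + (q - q4) ^ 2 ≤ 1)
    (h14 : (p1 - p4) ^ 2 + (q1 - q4) ^ 2 ≤ 1) (h23 : (p2 - p3) ^ 2 ≤ 1)
    (hs : q * (p2 - p3) ≥ 0) :
    |t| * ((p1 * q - q1 * p2) + (p2 * q - q * p3) + (p3 * q4 - q * p4)) ≤ B := by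
  have key : ∀ t z2 z3 : ℝ, 0 ≤ t → t ^ 2 ≤ 1 → z2 ^ 2 + p2 ^ 2 + q ^ 2 ≤ 1 →
      (z2 - t) ^ 2 + p2 ^ 2 + q ^ 2 ≤ 1 → z3 ^ 2 + p3 ^ 2 + q ^ 2 ≤ 1 →
      (z3 - t) ^ 2 + p3 ^ 2 + q ^ 2 ≤ 1 →
      t * ((p1 * q - q1 * p2) + (p2 * q - q * p3) + (p3 * q4 - q * p4)) ≤ B := by
    intro t z2 z3 ht ht1 ha2 hb2 ha3 hb3
    rcases le_total p2 p3 with hx | hx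
    · exact path_bound1 B t z2 z3 p1 p2 p3 p4 q1 q q4 hB ht ht1 ha2 hb2 ha3 hb3 h13 h24 h14 h23 hx hs
    · have := path_bound1 B t z2 z3 (-p1) (-p2) (-p3) (-p4) (-q1) (-q) (-q4) hB ht ht1
        (by linarith [neg_sq p2, neg_sq q]) (by linarith [neg_sq p2, neg_sq q])
        (by linarith [neg_sq p3, neg_sq q]) (by linarith [neg_sq p3, neg_sq q])
        (by linarith [show (-p1 - -p3) ^ 2 = (p1 - p3) ^ 2 by ring,
          show (-q1 - -q) ^ 2 = (q1 - q) ^ 2 by ring])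
        (by linarith [show (-p2 - -p4) ^ 2 = (p2 - p4) ^ 2 by ring,
          show (-q - -q4) ^ 2 = (q - q4) ^ 2 by ring])
        (by linarith [show (-p1 - -p4) ^ 2 = (p1 - p4) ^ 2 by ring,
          show (-q1 - -q4) ^ 2 = (q1 - q4) ^ 2 by ring])
        (by linarith [show (-p2 - -p3) ^ 2 = (p2 - p3) ^ 2 by ring]) (by linarith)
        (by linarith [show -q * (-p2 - -p3) = q * (p2 - p3) by ring])
      refine le_of_eq_of_le ?_ this
      ring
  rcases abs_cases t with ⟨h, h'⟩ | ⟨h, h'⟩ <;> rw [h]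
  · exact key t z2 z3 h' ht1 ha2 hb2 ha3 hb3
  · exact key (-t) (-z2) (-z3) (by linarith) (by linarith [neg_sq t]) (by linarith [neg_sq z2])
      (by linarith [neg_sq (z2 - t), show (-z2 - -t) = -(z2 - t) by ring, show (-z2 - -t)^2 = (z2 - t)^2 by ring])
      (by linarith [neg_sq z3]) (by linarith [show (-z3 - -t)^2 = (z3 - t)^2 by ring])

/-- Three tetrahedra around the edge, arranged in a path. -/
lemma path_bound (B t z2 z3 p1 p2 p3 p4 q1 q q4 : ℝ) (hB : GoodB B) (ht1 : t ^ 2 ≤ 1)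
    (ha2 : z2 ^ 2 + p2 ^ 2 + q ^ 2 ≤ 1) (hb2 : (z2 - t) ^ 2 + p2 ^ 2 + q ^ 2 ≤ 1)
    (ha3 : z3 ^ 2 + p3 ^ 2 + q ^ 2 ≤ 1) (hb3 : (z3 - t) ^ 2 + p3 ^ 2 + q ^ 2 ≤ 1)
    (h13 : (p1 - p3) ^ 2 + (q1 - q) ^ 2 ≤ 1) (h24 : (p2 - p4) ^ 2 + (q - q4) ^ 2 ≤ 1)
    (h14 : (p1 - p4) ^ 2 + (q1 - q4) ^ 2 ≤ 1) (h23 : (p2 - p3) ^ 2 ≤ 1)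
    (hs : (0 ≤ t * (p1 * q - q1 * p2) ∧ 0 ≤ t * (p2 * q - q * p3) ∧ 0 ≤ t * (p3 * q4 - q * p4)) ∨
      (t * (p1 * q - q1 * p2) ≤ 0 ∧ t * (p2 * q - q * p3) ≤ 0 ∧ t * (p3 * q4 - q * p4) ≤ 0)) :
    |t * ((p1 * q - q1 * p2) + (p2 * q - q * p3) + (p3 * q4 - q * p4))| ≤ B := by
  have hB0 : 0 ≤ B := by linarith [hB.1]
  rcases eq_or_ne t 0 with rfl | htn
  · simpa using hB0
  rw [abs_mul]
  -- reduce to the case where all are of one sign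
  have two : (0 ≤ (p1 * q - q1 * p2) ∧ 0 ≤ (p2 * q - q * p3) ∧ 0 ≤ (p3 * q4 - q * p4)) ∨
      ((p1 * q - q1 * p2) ≤ 0 ∧ (p2 * q - q * p3) ≤ 0 ∧ (p3 * q4 - q * p4) ≤ 0) := by
    rcases lt_or_gt_of_ne htn with ht | ht
    · have k1 : ∀ c : ℝ, 0 ≤ t * c → c ≤ 0 := fun c hc => by
        by_contra h; push Not at h; exact absurd hc (not_le.2 (mul_neg_of_neg_of_pos ht h))
      have k2 : ∀ c : ℝ, t * c ≤ 0 → 0 ≤ c := fun c hc => by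
        by_contra h; push Not at h; exact absurd hc (not_le.2 (mul_pos_of_neg_of_neg ht h))
      rcases hs with ⟨h1, h2, h3⟩ | ⟨h1, h2, h3⟩
      · exact Or.inr ⟨k1 _ h1, k1 _ h2, k1 _ h3⟩
      · exact Or.inl ⟨k2 _ h1, k2 _ h2, k2 _ h3⟩
    · have k1 : ∀ c : ℝ, 0 ≤ t * c → 0 ≤ c := fun c hc => by
        by_contra h; push Not at h; exact absurd hc (not_le.2 (mul_neg_of_pos_of_neg ht h))
      have k2 : ∀ c : ℝ, t * c ≤ 0 → c ≤ 0 := fun c hc => by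
        by_contra h; push Not at h; exact absurd hc (not_le.2 (mul_pos ht h))
      rcases hs with ⟨h1, h2, h3⟩ | ⟨h1, h2, h3⟩
      · exact Or.inl ⟨k1 _ h1, k1 _ h2, k1 _ h3⟩
      · exact Or.inr ⟨k2 _ h1, k2 _ h2, k2 _ h3⟩
  rcases two with ⟨h1, h2, h3⟩ | ⟨h1, h2, h3⟩
  · rw [abs_of_nonneg (by linarith : (0:ℝ) ≤ (p1 * q - q1 * p2) + (p2 * q - q * p3) + (p3 * q4 - q * p4))]
    exact path_bound2 B t z2 z3 p1 p2 p3 p4 q1 q q4 hB ht1 ha2 hb2 ha3 hb3 h13 h24 h14 h23 (by linarith)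
  · rw [abs_of_nonpos (by linarith : (p1 * q - q1 * p2) + (p2 * q - q * p3) + (p3 * q4 - q * p4) ≤ (0:ℝ))]
    have := path_bound2 B t z2 z3 p1 p2 p3 p4 (-q1) (-q) (-q4) hB ht1 (by linarith [neg_sq q])
      (by linarith [neg_sq q]) (by linarith [neg_sq q]) (by linarith [neg_sq q])
      (by linarith [show (-q1 - -q)^2 = (q1-q)^2 by ring])
      (by linarith [show (-q - -q4)^2 = (q-q4)^2 by ring])
      (by linarith [show (-q1 - -q4)^2 = (q1-q4)^2 by ring]) h23 (by linarith)
    refine le_of_eq_of_le ?_ this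
    ring

/-- Euclidean three-space. -/
abbrev E3 := EuclideanSpace ℝ (Fin 3)

/-- If all lower bounds are below all upper bounds, something lies in between. -/
lemma exists_mid {ι : Type*} [Finite ι] (P N : ι → Prop) (a b : ι → ℝ)
    (h : ∀ i j, P i → N j → a i ≤ b j) :
    ∃ y, (∀ i, P i → a i ≤ y) ∧ (∀ j, N j → y ≤ b j) := by
  by_cases hP : ∃ i, P i
  · have hfin : (a '' {i | P i}).Finite := (Set.toFinite _).image _
    refine ⟨sSup (a '' {i | P i}), fun i hi => le_csSup hfin.bddAbove ⟨i, hi, rfl⟩, fun j hj => ?_⟩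
    obtain ⟨i, hi⟩ := hP
    refine csSup_le ⟨a i, i, hi, rfl⟩ ?_
    rintro _ ⟨k, hk, rfl⟩
    exact h k j hk hj
  · have hfin : (b '' {i | N i}).Finite := (Set.toFinite _).image _
    push Not at hP
    exact ⟨sInf (b '' {i | N i}), fun i hi => absurd hi (hP i),
      fun j hj => csInf_le hfin.bddBelow ⟨j, hj, rfl⟩⟩

/-- Two-by-two minors. -/
def nn (α β : Fin 6 → ℝ) (i j : Fin 6) : ℝ := α i * β j - α j * β i

lemma lp_lemma (α β l : Fin 6 → ℝ) (hα : ∑ i, α i = 0) (hβ : ∑ i, β i = 0)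
    (hn : nn α β 0 1 ≠ 0) (ha : ∀ i, α i ≠ 0) (hl : l ∈ stdSimplex ℝ (Fin 6)) :
    ∃ m ∈ stdSimplex ℝ (Fin 6), ∃ y z : ℝ, (∀ k, m k = l k + y * α k + z * β k) ∧
      ∃ i j, m i = 0 ∧ m j = 0 ∧ 0 < α i ∧ α j < 0 ∧ nn α β i j < 0 := by
  let Y : (Fin 6 → ℝ) → ℝ := fun m => ((m 0 - l 0) * β 1 - (m 1 - l 1) * β 0) / nn α β 0 1
  let Z : (Fin 6 → ℝ) → ℝ := fun m => (α 0 * (m 1 - l 1) - α 1 * (m 0 - l 0)) / nn α β 0 1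
  have hY : Continuous Y := by fun_prop
  have hZ : Continuous Z := by fun_prop
  have hYv : ∀ m y z, (∀ k, m k = l k + y * α k + z * β k) → Y m = y := by
    intro m y z h
    simp only [Y]
    rw [div_eq_iff hn, h 0, h 1, nn]; ring
  have hZv : ∀ m y z, (∀ k, m k = l k + y * α k + z * β k) → Z m = z := by
    intro m y z h
    simp only [Z]
    rw [div_eq_iff hn, h 0, h 1, nn]; ring
  let K : Set (Fin 6 → ℝ) := stdSimplex ℝ (Fin 6) ∩ {m | ∀ k, m k = l k + Y m * α k + Z m * β k}
  have hK : IsCompact K := by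
    refine (isCompact_stdSimplex ℝ (Fin 6)).inter_right ?_
    simp only [Set.ofPred_forall]
    exact isClosed_iInter fun k => isClosed_eq (by fun_prop) (by fun_prop)
  have hmem : ∀ m y z, m ∈ stdSimplex ℝ (Fin 6) → (∀ k, m k = l k + y * α k + z * β k) → m ∈ K := by
    intro m y z hm h
    refine ⟨hm, ?_⟩
    show ∀ k, m k = l k + Y m * α k + Z m * β k
    rw [hYv m y z h, hZv m y z h]; exact h
  have hne : K.Nonempty := ⟨l, hmem l 0 0 hl (by simp)⟩
  obtain ⟨m, hmK, hmax⟩ := hK.exists_isMaxOn hne hZ.continuousOn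
  refine ⟨m, hmK.1, Y m, Z m, hmK.2, ?_⟩
  by_contra hcon
  push Not at hcon
  obtain ⟨y, hy1, hy2⟩ := exists_mid (fun i => m i = 0 ∧ 0 < α i) (fun j => m j = 0 ∧ α j < 0)
    (fun i => - β i / α i) (fun i => -β i / α i) (by
      rintro i j ⟨hi, hi'⟩ ⟨hj, hj'⟩
      have := hcon i j hi hj hi' hj'
      rw [div_le_iff₀ hi', div_mul_eq_mul_div, le_div_iff_of_neg hj']
      unfold nn at this
      linarith)
  have hc : ∀ k, m k = 0 → 0 ≤ y * α k + β k := by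
    intro k hk
    rcases lt_or_gt_of_ne (ha k) with h | h
    · have := hy2 k ⟨hk, h⟩
      rw [le_div_iff_of_neg h] at this; linarith
    · have := hy1 k ⟨hk, h⟩
      rw [div_le_iff₀ h] at this; linarith
  have hev : ∀ᶠ e : ℝ in nhdsWithin 0 (Set.Ioi 0), ∀ k, 0 ≤ m k + e * (y * α k + β k) := by
    rw [Filter.eventually_all]
    intro k
    rcases (hmK.1.1 k).eq_or_lt with h | h
    · filter_upwards [self_mem_nhdsWithin] with e he
      have he' : (0 : ℝ) < e := he
      have := hc k h.symm
      rw [← h]; positivity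
    · have hcont : Continuous fun e : ℝ => m k + e * (y * α k + β k) := by fun_prop
      have h2 : ∀ᶠ e : ℝ in nhds 0, 0 < m k + e * (y * α k + β k) :=
        (hcont.tendsto' 0 (m k) (by simp)).eventually (lt_mem_nhds h)
      filter_upwards [nhdsWithin_le_nhds h2] with e he using he.le
  obtain ⟨e, he, he0⟩ := (hev.and self_mem_nhdsWithin).exists
  have he0' : (0 : ℝ) < e := he0
  let m' : Fin 6 → ℝ := fun k => m k + e * (y * α k + β k)
  have hm's : m' ∈ stdSimplex ℝ (Fin 6) := by
    refine ⟨he, ?_⟩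
    simp only [m', Finset.sum_add_distrib, ← Finset.mul_sum, hα, hβ, hmK.1.2]
    simp
  have hm'f : ∀ k, m' k = l k + (Y m + e * y) * α k + (Z m + e) * β k := by
    intro k
    have := hmK.2 k
    simp only [m']
    linarith
  have h1 := hmax (hmem m' _ _ hm's hm'f)
  have h2 : Z m' ≤ Z m := h1
  rw [hZv m' _ _ hm'f] at h2
  linarith

/-- The triple product in coordinates. -/
def trip (u v w : E3) : ℝ :=
  u 0 * (v 1 * w 2 - v 2 * w 1) - u 1 * (v 0 * w 2 - v 2 * w 0) + u 2 * (v 0 * w 1 - v 1 * w 0)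

/-- Six times the signed volume of the tetrahedron `g 0, g 1, g x, g y`. -/
def Tri (g : Fin 6 → E3) (x y : Fin 6) : ℝ := trip (g 1 - g 0) (g x - g 0) (g y - g 0)

/-- The five possible types of dissections around the edge `g 0, g 1`. -/
def T : Fin 5 → List (Fin 6 × Fin 6) :=
  ![[(2, 3)], [(2, 3), (3, 4)], [(2, 3), (3, 4), (4, 2)], [(2, 3), (3, 4), (4, 5), (5, 2)],
    [(2, 3), (3, 4), (4, 5)]]

/-- The tetrahedra in the list cover the hull. -/
def Cov (s g : Fin 6 → E3) (l : List (Fin 6 × Fin 6)) : Prop :=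
  ∀ c ∈ stdSimplex ℝ (Fin 6), ∃ p ∈ l, ∃ m ∈ stdSimplex ℝ (Fin 4),
    ∑ k, c k • s k = m 0 • g 0 + m 1 • g 1 + m 2 • g p.1 + m 3 • g p.2

/-- The tetrahedra in the list have the same orientation. -/
def SameSign (g : Fin 6 → E3) (l : List (Fin 6 × Fin 6)) : Prop :=
  (∀ p ∈ l, 0 ≤ Tri g p.1 p.2) ∨ (∀ p ∈ l, Tri g p.1 p.2 ≤ 0)

/-- The configuration has a good dissection. -/
def Good (s : Fin 6 → E3) : Prop :=
  ∃ f : Fin 6 → Fin 6, ∃ k : Fin 5, Cov s (s ∘ f) (T k) ∧ SameSign (s ∘ f) (T k)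

/-- Affine dependencies. -/
def Dep (s : Fin 6 → E3) (α : Fin 6 → ℝ) : Prop := ∑ i, α i = 0 ∧ ∑ i, α i • s i = 0

/-- The four indices are the four inner ones. -/
def dist4 (i j k l : Fin 6) : Prop :=
  (Finset.univ : Finset (Fin 6)) = {0, 5, i, j, k, l}

instance (i j k l : Fin 6) : Decidable (dist4 i j k l) := by unfold dist4; infer_instance

lemma sum_dist4 {M : Type*} [AddCommMonoid M] (F : Fin 6 → M) (i j k l : Fin 6)
    (h : dist4 i j k l) : ∑ x, F x = F 0 + F 5 + F i + F j + F k + F l := by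
  have hnd : [0, 5, i, j, k, l].Nodup := by
    revert i j k l; decide
  have : (Finset.univ : Finset (Fin 6)) = [0, 5, i, j, k, l].toFinset := by
    rw [h]; ext; simp
  rw [this, List.sum_toFinset F hnd]
  simp [add_assoc]

/-- Link condition. -/
def Lk (r : Fin 6 → Bool) (f : Fin 6 → Fin 6) (p q : Fin 6 × Fin 6) : Prop :=
  p.2 = q.1 ∧ ∃ i, dist4 i (f p.1) (f p.2) (f q.2) ∧
    ((r i = true ∧ r (f p.1) = false ∧ r (f q.2) = false ∧ i < f p.1 ∧ i < f q.2) ∨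
     (r i = false ∧ r (f p.1) = true ∧ r (f q.2) = true ∧ f p.1 < i ∧ f q.2 < i))

instance (r f p q) : Decidable (Lk r f p q) := by unfold Lk; infer_instance

/-- Combinatorial covering condition. -/
def CC (r : Fin 6 → Bool) (f : Fin 6 → Fin 6) (k : Fin 5) : Prop :=
  ∀ i j : Fin 6, i < j → 0 < i → j < 5 → r i = true → r j = false →
    ∃ p ∈ T k, dist4 i j (f p.1) (f p.2)

instance (r f k) : Decidable (CC r f k) := by unfold CC; infer_instance

set_option maxRecDepth 10000 in
lemma comb (r1 r2 r3 r4 : Bool) : ∃ c1 c2 c3 c4 : Fin 6, ∃ k : Fin 5,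
    CC ![false, r1, r2, r3, r4, true] ![0, 5, c1, c2, c3, c4] k ∧
    (T k).IsChain (Lk ![false, r1, r2, r3, r4, true] ![0, 5, c1, c2, c3, c4]) := by
  match r1, r2, r3, r4 with
  | true, true, false, false => exact ⟨2, 4, 1, 3, 3, by decide⟩
  | true, false, true, false => exact ⟨4, 3, 2, 1, 4, by decide⟩
  | true, true, true, false => exact ⟨1, 2, 3, 0, 2, by decide⟩
  | true, false, false, false => exact ⟨2, 3, 4, 0, 2, by decide⟩
  | true, false, false, true => exact ⟨3, 4, 2, 0, 1, by decide⟩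
  | true, true, false, true => exact ⟨2, 4, 1, 0, 1, by decide⟩
  | false, true, true, false => exact ⟨3, 1, 2, 0, 1, by decide⟩
  | false, true, false, false => exact ⟨4, 1, 3, 0, 1, by decide⟩
  | false, true, false, true => exact ⟨1, 4, 0, 0, 0, by decide⟩
  | false, false, true, false => exact ⟨1, 2, 0, 0, 0, by decide⟩
  | true, false, true, true => exact ⟨3, 4, 0, 0, 0, by decide⟩
  | true, true, true, true => exact ⟨3, 4, 0, 0, 0, by decide⟩
  | false, true, true, true => exact ⟨3, 4, 0, 0, 0, by decide⟩
  | false, false, true, true => exact ⟨3, 4, 0, 0, 0, by decide⟩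
  | false, false, false, true => exact ⟨3, 4, 0, 0, 0, by decide⟩
  | false, false, false, false => exact ⟨3, 4, 0, 0, 0, by decide⟩

lemma chain_sign {ι : Type*} (F : ι → ℝ) (l : List ι)
    (h : l.IsChain (fun p q => ∃ c > 0, F p = c * F q)) :
    (∀ p ∈ l, 0 ≤ F p) ∨ (∀ p ∈ l, F p ≤ 0) := by
  induction l with
  | nil => simp
  | cons p l ih =>
    cases l with
    | nil => simpa using le_total 0 (F p)
    | cons q l =>
      rw [List.isChain_cons_cons] at h
      obtain ⟨⟨c, hc, hpq⟩, h⟩ := h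
      rcases ih h with ih | ih
      · left
        rw [List.forall_mem_cons]
        refine ⟨?_, ih⟩
        have := ih q (by simp)
        rw [hpq]; positivity
      · right
        rw [List.forall_mem_cons]
        refine ⟨?_, ih⟩
        have := ih q (by simp)
        rw [hpq]; exact mul_nonpos_of_nonneg_of_nonpos hc.le this

lemma dep_coord {s : Fin 6 → E3} {α : Fin 6 → ℝ} (h : Dep s α) {i j k l : Fin 6}
    (hd : dist4 i j k l) (c : Fin 3) :
    α 5 * (s 5 - s 0) c + α i * (s i - s 0) c + α j * (s j - s 0) c + α k * (s k - s 0) c +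
      α l * (s l - s 0) c = 0 := by
  have h1 := h.1
  have h2 := congrArg (fun v : E3 => v c) h.2
  rw [sum_dist4 _ i j k l hd] at h1 h2
  simp only [PiLp.add_apply, PiLp.smul_apply, smul_eq_mul, PiLp.zero_apply] at h2
  simp only [PiLp.sub_apply]
  linear_combination h2 - s 0 c * h1

lemma dep_tri {s : Fin 6 → E3} {α : Fin 6 → ℝ} (h : Dep s α) {i j k l : Fin 6}
    (hd : dist4 i j k l) :
    α i * trip (s 5 - s 0) (s i - s 0) (s k - s 0) + α j * trip (s 5 - s 0) (s j - s 0) (s k - s 0)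
      + α l * trip (s 5 - s 0) (s l - s 0) (s k - s 0) = 0 := by
  have h0 := dep_coord h hd 0
  have h1 := dep_coord h hd 1
  have h2 := dep_coord h hd 2
  generalize s 5 - s 0 = u5 at *
  generalize s i - s 0 = ui at *
  generalize s j - s 0 = uj at *
  generalize s k - s 0 = uk at *
  generalize s l - s 0 = ul at *
  unfold trip
  linear_combination (u5 2 * uk 1 - u5 1 * uk 2) * h0 + (u5 0 * uk 2 - u5 2 * uk 0) * h1 +
    (u5 1 * uk 0 - u5 0 * uk 1) * h2

lemma trip_swap (u v w : E3) : trip u v w = - trip u w v := by unfold trip; ring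

lemma dep_link {s : Fin 6 → E3} {α β : Fin 6 → ℝ} (h : Dep s α) (h' : Dep s β) {i j k l : Fin 6}
    (hd : dist4 i j k l) :
    nn α β i j * trip (s 5 - s 0) (s j - s 0) (s k - s 0) =
      nn α β i l * trip (s 5 - s 0) (s k - s 0) (s l - s 0) := by
  have h1 := dep_tri h hd
  have h2 := dep_tri h' hd
  rw [trip_swap _ (s k - s 0)]
  unfold nn
  linear_combination α i * h2 - β i * h1

lemma good_of_sorted (s : Fin 6 → E3) (α β : Fin 6 → ℝ) (hα : Dep s α) (hβ : Dep s β)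
    (ha : ∀ i, α i ≠ 0) (hord : ∀ i j, i < j → 0 < α i * α j * nn α β i j)
    (h0 : α 0 < 0) (h5 : 0 < α 5) : Good s := by
  obtain ⟨r, hr⟩ : ∃ r : Fin 6 → Bool, r = fun i => decide (0 < α i) := ⟨_, rfl⟩
  have hre : r = ![false, r 1, r 2, r 3, r 4, true] := by
    funext i
    fin_cases i <;> simp [hr, h0.le, h5]
  have rt : ∀ i, r i = true → 0 < α i := by intro i hi; simpa [hr] using hi
  have rt' : ∀ i, 0 < α i → r i = true := by intro i hi; simpa [hr] using hi
  have rf : ∀ i, r i = false → α i < 0 := by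
    intro i hi; exact lt_of_le_of_ne (by simpa [hr] using hi) (ha i)
  have rf' : ∀ i, α i < 0 → r i = false := by intro i hi; simpa [hr] using hi.le
  have hneg : ∀ i j, i < j → α i * α j < 0 → nn α β i j < 0 := by
    intro i j hij h
    by_contra hn
    push Not at hn
    have := hord i j hij
    nlinarith
  have hanti : ∀ i j, nn α β i j = - nn α β j i := by intro i j; unfold nn; ring
  obtain ⟨c1, c2, c3, c4, k, hcc, hch⟩ := comb (r 1) (r 2) (r 3) (r 4)
  rw [← hre] at hcc hch
  refine ⟨![0, 5, c1, c2, c3, c4], k, ?_, ?_⟩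
  · intro c hc
    obtain ⟨m, hm, y, z, hmk, i, j, hi, hj, hai, haj, hnij⟩ :=
      lp_lemma α β c hα.1 hβ.1 (by
        have := hord 0 1 (by decide)
        intro h; rw [h] at this; simp at this) ha hc
    have hij : i < j := by
      by_contra hij
      rcases (not_lt.1 hij).eq_or_lt with h | h
      · subst h; linarith
      · have := hneg j i h (mul_neg_of_neg_of_pos haj hai)
        rw [hanti] at hnij; linarith
    have hi0 : 0 < i := by
      rw [Fin.pos_iff_ne_zero]; rintro rfl; linarith
    have hj5 : j < 5 := by
      rw [lt_iff_le_and_ne]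
      refine ⟨Fin.le_last j, ?_⟩
      rintro rfl; linarith
    obtain ⟨p, hp, hd⟩ := hcc i j hij hi0 hj5 (rt' i hai) (rf' j haj)
    refine ⟨p, hp, ![m 0, m 5, m ((![0, 5, c1, c2, c3, c4] : Fin 6 → Fin 6) p.1),
      m ((![0, 5, c1, c2, c3, c4] : Fin 6 → Fin 6) p.2)], ⟨?_, ?_⟩, ?_⟩
    · intro x; fin_cases x <;> exact hm.1 _
    · have := hm.2
      rw [sum_dist4 _ _ _ _ _ hd, hi, hj] at this
      rw [Fin.sum_univ_four]
      simpa using this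
    · have e1 : ∑ x, c x • s x = ∑ x, m x • s x := by
        have : ∀ x, m x • s x = c x • s x + y • (α x • s x) + z • (β x • s x) := by
          intro x; rw [hmk x, add_smul, add_smul, mul_smul, mul_smul]
        simp only [this, Finset.sum_add_distrib, ← Finset.smul_sum, hα.2, hβ.2]
        simp
      rw [e1, sum_dist4 _ _ _ _ _ hd, hi, hj]
      simp
  · apply chain_sign (fun p : Fin 6 × Fin 6 => Tri (s ∘ ![0, 5, c1, c2, c3, c4]) p.1 p.2)
    refine hch.imp ?_
    rintro ⟨p1, p2⟩ ⟨q1, q2⟩ ⟨h1, i, hd, h⟩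
    simp only at h1 hd h
    subst h1
    have hl := dep_link hα hβ hd
    have : 0 < nn α β i ((![0, 5, c1, c2, c3, c4] : Fin 6 → Fin 6) q2) /
        nn α β i ((![0, 5, c1, c2, c3, c4] : Fin 6 → Fin 6) p1) := by
      rcases h with ⟨ha1, ha2, ha3, ha4, ha5⟩ | ⟨ha1, ha2, ha3, ha4, ha5⟩
      · exact div_pos_of_neg_of_neg (hneg _ _ ha5 (mul_neg_of_pos_of_neg (rt _ ha1) (rf _ ha3)))
          (hneg _ _ ha4 (mul_neg_of_pos_of_neg (rt _ ha1) (rf _ ha2)))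
      · rw [hanti i, hanti i, neg_div_neg_eq]
        exact div_pos_of_neg_of_neg (hneg _ _ ha5 (mul_neg_of_pos_of_neg (rt _ ha3) (rf _ ha1)))
          (hneg _ _ ha4 (mul_neg_of_pos_of_neg (rt _ ha2) (rf _ ha1)))
    refine ⟨_, this, ?_⟩
    have hne : nn α β i ((![0, 5, c1, c2, c3, c4] : Fin 6 → Fin 6) p1) ≠ 0 := by
      intro h; rw [h] at this; simp at this
    show trip (s 5 - s 0) _ _ = _ * trip (s 5 - s 0) _ _
    rw [div_mul_eq_mul_div, eq_div_iff hne]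
    rw [mul_comm]
    exact hl

lemma good_perm (s : Fin 6 → E3) (σ : Equiv.Perm (Fin 6)) (h : Good (s ∘ σ)) : Good s := by
  obtain ⟨f, k, hc, hs⟩ := h
  refine ⟨σ ∘ f, k, ?_, hs⟩
  intro c hc'
  have := hc (c ∘ σ) ⟨fun x => hc'.1 _, by
    have := Equiv.sum_comp σ c
    simp only [Function.comp]; rw [this]; exact hc'.2⟩
  have e := Equiv.sum_comp σ (fun x => c x • s x)
  simp only [Function.comp] at this e ⊢
  rw [e] at this
  exact this

lemma dep_perm {s : Fin 6 → E3} {α : Fin 6 → ℝ} (h : Dep s α) (σ : Equiv.Perm (Fin 6)) :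
    Dep (s ∘ σ) (α ∘ σ) :=
  ⟨by rw [← h.1]; exact Equiv.sum_comp σ α,
   by rw [← h.2]; exact Equiv.sum_comp σ (fun x => α x • s x)⟩

lemma dep_comb {s : Fin 6 → E3} {α β : Fin 6 → ℝ} (h : Dep s α) (h' : Dep s β) (a b : ℝ) :
    Dep s (fun k => a * α k + b * β k) := by
  constructor
  · rw [Finset.sum_add_distrib, ← Finset.mul_sum, ← Finset.mul_sum, h.1, h'.1]; simp
  · simp only [add_smul, mul_smul, Finset.sum_add_distrib, ← Finset.smul_sum, h.2, h'.2]; simp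

lemma ord_of_lt {α β : Fin 6 → ℝ} {i j : Fin 6} (hi : α i ≠ 0) (hj : α j ≠ 0)
    (h : β i / α i < β j / α j) : 0 < α i * α j * nn α β i j := by
  have e : α i * α j * nn α β i j = (α i) ^ 2 * (α j) ^ 2 * (β j / α j - β i / α i) := by
    unfold nn; field_simp
  rw [e]
  have : 0 < β j / α j - β i / α i := by linarith
  positivity

lemma good_caseA (s : Fin 6 → E3) (α β : Fin 6 → ℝ) (hα : Dep s α) (hβ : Dep s β)
    (ha : ∀ i, α i ≠ 0) (hm : ∀ i j, i < j → β i / α i < β j / α j) (h : α 0 * α 5 < 0) :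
    Good s := by
  rcases lt_or_gt_of_ne (ha 0) with h0 | h0
  · exact good_of_sorted s α β hα hβ ha (fun i j hij => ord_of_lt (ha i) (ha j) (hm i j hij)) h0
      (by by_contra hc; nlinarith)
  · have h5 : α 5 < 0 := by
      by_contra hc; push Not at hc; exact absurd h (not_lt.2 (mul_nonneg h0.le hc))
    refine good_of_sorted s (fun k => -1 * α k + 0 * β k) (fun k => -1 * β k + 0 * α k)
      (dep_comb hα hβ _ _) (dep_comb hβ hα _ _) (fun i => by simpa using ha i) ?_ (by linarith)
      (by linarith)
    intro i j hij
    have := ord_of_lt (ha i) (ha j) (hm i j hij)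
    unfold nn at this ⊢
    linarith

lemma good_of_mono (s : Fin 6 → E3) (α β : Fin 6 → ℝ) (hα : Dep s α) (hβ : Dep s β)
    (ha : ∀ i, α i ≠ 0) (hm : ∀ i j, i < j → β i / α i < β j / α j) :
    Good s := by
  by_cases hB : ∃ r r' : Fin 6, (r : ℕ) = r' + 1 ∧ 0 < α r' * α r
  · obtain ⟨r, r', hr, hrr⟩ := hB
    obtain ⟨c, hc1, hc2⟩ := exists_between (hm r' r (by rw [Fin.lt_def]; omega))
    have hmle : ∀ i j, i ≤ j → β i / α i ≤ β j / α j := by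
      intro i j hij
      rcases hij.eq_or_lt with h | h
      · rw [h]
      · exact (hm i j h).le
    have hge : ∀ k, r ≤ k → c < β k / α k := fun k hk => hc2.trans_le (hmle _ _ hk)
    have hlt : ∀ k, k < r → β k / α k < c := fun k hk =>
      (hmle k r' (by rw [Fin.le_def]; rw [Fin.lt_def] at hk; omega)).trans_lt hc1
    have hα' : ∀ k, -c * α k + 1 * β k = α k * (β k / α k - c) := by
      intro k; have := ha k; field_simp; ring
    have hne : ∀ k, β k / α k - c ≠ 0 := by
      intro k
      rcases le_or_gt r k with h | h
      · have := hge k h; exact ne_of_gt (by linarith)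
      · have := hlt k h; exact ne_of_lt (by linarith)
    have hne' : ∀ k, -c * α k + 1 * β k ≠ 0 := fun k => by
      rw [hα']; exact mul_ne_zero (ha k) (hne k)
    have hdiv : ∀ k, (-1 * α k + 0 * β k) / (-c * α k + 1 * β k) = -(1 / (β k / α k - c)) := by
      intro k
      rw [hα']
      have := ha k
      have := hne k
      rw [neg_div', div_eq_div_iff (mul_ne_zero (ha k) (hne k)) (hne k)]
      ring
    apply good_perm s (Equiv.addRight r)
    refine good_caseA _ ((fun k => -c * α k + 1 * β k) ∘ (Equiv.addRight r))
      ((fun k => -1 * α k + 0 * β k) ∘ (Equiv.addRight r)) (dep_perm (dep_comb hα hβ _ _) _)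
      (dep_perm (dep_comb hα hβ _ _) _) (fun k => hne' _) ?_ ?_
    · intro i j hij
      simp only [Function.comp, Equiv.coe_addRight]
      rw [hdiv, hdiv]
      have hcases : (i + r < j + r ∧ r ≤ i + r ∧ r ≤ j + r) ∨
          (i + r < j + r ∧ i + r < r ∧ j + r < r) ∨ (r ≤ i + r ∧ j + r < r) := by
        clear * - hij
        revert i j r; decide
      rcases hcases with ⟨h1, h2, h3⟩ | ⟨h1, h2, h3⟩ | ⟨h2, h3⟩
      · rw [neg_lt_neg_iff]
        have h2 := hge _ h2
        have h3 := hge _ h3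
        have h1 := hm _ _ h1
        exact one_div_lt_one_div_of_lt (by linarith) (by linarith)
      · rw [neg_lt_neg_iff]
        have h2 := hlt _ h2
        have h3 := hlt _ h3
        have h1 := hm _ _ h1
        exact one_div_lt_one_div_of_neg_of_lt (by linarith) (by linarith)
      · have h2 := hge _ h2
        have h3 := hlt _ h3
        have h4 : 0 < 1 / (β (i + r) / α (i + r) - c) := by
          apply one_div_pos.2; linarith
        have h5 : 1 / (β (j + r) / α (j + r) - c) < 0 := by
          apply one_div_neg.2; linarith
        linarith
    · simp only [Function.comp, Equiv.coe_addRight]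
      have e0 : (0 : Fin 6) + r = r := zero_add r
      have e5 : (5 : Fin 6) + r = r' := by
        clear * - hr
        revert r r'; decide
      rw [e0, e5, hα', hα']
      have h1 := hge r le_rfl
      have h2 := hlt r' (by rw [Fin.lt_def]; omega)
      have h3 : 0 < (β r / α r - c) * (c - β r' / α r') := mul_pos (by linarith) (by linarith)
      nlinarith [mul_pos hrr h3]
  · push Not at hB
    have hlt : ∀ r r' : Fin 6, (r : ℕ) = r' + 1 → α r' * α r < 0 := fun r r' h =>
      lt_of_le_of_ne (hB r r' h) (mul_ne_zero (ha _) (ha _))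
    have h1 := hlt 1 0 rfl
    have h2 := hlt 2 1 rfl
    have h3 := hlt 3 2 rfl
    have h4 := hlt 4 3 rfl
    have h5 := hlt 5 4 rfl
    apply good_caseA s α β hα hβ ha hm
    have p12 := mul_pos_of_neg_of_neg h1 h2
    have p34 := mul_pos_of_neg_of_neg h3 h4
    have p := mul_neg_of_pos_of_neg (mul_pos p12 p34) h5
    have e : α 0 * α 1 * (α 1 * α 2) * (α 2 * α 3 * (α 3 * α 4)) * (α 4 * α 5) =
      (α 0 * α 5) * (α 1 * α 2 * α 3 * α 4) ^ 2 := by ring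
    rw [e] at p
    by_contra hc
    push Not at hc
    exact absurd p (not_lt.2 (mul_nonneg hc (sq_nonneg _)))

lemma good_of_dep (s : Fin 6 → E3) (α β : Fin 6 → ℝ) (hα : Dep s α) (hβ : Dep s β)
    (hn : ∀ i j, i ≠ j → nn α β i j ≠ 0) : Good s := by
  obtain ⟨c, hc⟩ : ∃ c : ℝ, ∀ i, α i + c * β i ≠ 0 := by
    have hfin : (Set.range fun i => -α i / β i).Finite := Set.finite_range _
    obtain ⟨c, hc⟩ := hfin.infinite_compl.nonempty
    refine ⟨c, fun i hi => ?_⟩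
    by_cases hb : β i = 0
    · rw [hb] at hi
      have : α i = 0 := by linarith
      exact hn i (i + 1) (by clear * -; revert i; decide) (by unfold nn; rw [hb, this]; ring)
    · apply hc
      refine ⟨i, ?_⟩
      simp only
      rw [div_eq_iff hb]; linarith
  let α' : Fin 6 → ℝ := fun k => 1 * α k + c * β k
  have hα' : Dep s α' := dep_comb hα hβ _ _
  have ha : ∀ i, α' i ≠ 0 := fun i => by simpa [α'] using hc i
  have hn' : ∀ i j, i ≠ j → nn α' β i j ≠ 0 := by
    intro i j hij h
    apply hn i j hij
    rw [← h]; unfold nn; simp only [α']; ring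
  let m : Fin 6 → ℝ := fun i => β i / α' i
  have hmono := Tuple.monotone_sort m
  apply good_perm s (Tuple.sort m)
  refine good_of_mono _ (α' ∘ Tuple.sort m) (β ∘ Tuple.sort m) (dep_perm hα' _) (dep_perm hβ _)
    (fun i => ha _) ?_
  intro i j hij
  refine lt_of_le_of_ne (hmono hij.le) ?_
  intro h
  apply hn' (Tuple.sort m i) (Tuple.sort m j) ((Tuple.sort m).injective.ne hij.ne)
  simp only [Function.comp] at h
  rw [div_eq_div_iff (ha _) (ha _)] at h
  unfold nn
  linarith

/-- The matrix of homogeneous coordinates of four of the points. -/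
def MM (s : Fin 6 → E3) (f : Fin 4 → Fin 6) : Matrix (Fin 4) (Fin 4) ℝ :=
  Matrix.of fun k => ![1, s (f k) 0, s (f k) 1, s (f k) 2]

/-- General position. -/
def Gen (s : Fin 6 → E3) : Prop := ∀ f : Fin 4 → Fin 6, Function.Injective f → (MM s f).det ≠ 0

lemma gen_dep {s : Fin 6 → E3} (hs : Gen s) {γ : Fin 6 → ℝ} (h : Dep s γ) {i j : Fin 6}
    (hij : i ≠ j) (hi : γ i = 0) (hj : γ j = 0) : γ = 0 := by
  have hcard : ({i, j}ᶜ : Finset (Fin 6)).card = 4 := by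
    rw [Finset.card_compl, Finset.card_pair hij]; rfl
  let f := ({i, j}ᶜ : Finset (Fin 6)).orderEmbOfFin hcard
  have hdet := hs f f.injective
  have hsum : ∀ F : Fin 6 → ℝ, F i = 0 → F j = 0 → ∑ k, F (f k) = ∑ x, F x := by
    intro F h1 h2
    have h3 : ∑ x ∈ ({i, j}ᶜ : Finset (Fin 6)), F x = ∑ x, F x := by
      rw [← Finset.sum_compl_add_sum ({i, j} : Finset (Fin 6)), Finset.sum_pair hij, h1, h2]
      simp
    rw [← h3, ← Finset.map_orderEmbOfFin_univ _ hcard, Finset.sum_map]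
    rfl
  have hv : Matrix.vecMul (fun k => γ (f k)) (MM s f) = 0 := by
    have hco : ∀ c : Fin 3, ∑ x, γ x * s x c = 0 := by
      intro c
      have h2 := congrArg (fun v : E3 => v c) h.2
      simpa using h2
    funext c
    simp only [Matrix.vecMul, dotProduct, Pi.zero_apply]
    fin_cases c
    · have := hsum γ hi hj
      simp [MM]
      rw [this]; exact h.1
    · have := hsum (fun x => γ x * s x 0) (by simp [hi]) (by simp [hj])
      simp [MM]
      rw [this]; exact hco 0
    · have := hsum (fun x => γ x * s x 1) (by simp [hi]) (by simp [hj])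
      simp [MM]
      rw [this]; exact hco 1
    · have := hsum (fun x => γ x * s x 2) (by simp [hi]) (by simp [hj])
      simp [MM]
      rw [this]; exact hco 2
  have hz := Matrix.eq_zero_of_vecMul_eq_zero hdet hv
  funext x
  by_cases hx : x ∈ ({i, j}ᶜ : Finset (Fin 6))
  · have : x ∈ Set.range f := by rw [Finset.range_orderEmbOfFin]; exact hx
    obtain ⟨k, rfl⟩ := this
    exact congrFun hz k
  · simp only [Finset.mem_compl, Finset.mem_insert, Finset.mem_singleton, not_not] at hx
    rcases hx with rfl | rfl
    · exact hi
    · exact hj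

lemma exists_deps (s : Fin 6 → E3) : ∃ α β : Fin 6 → ℝ, Dep s α ∧ Dep s β ∧
    ∀ a b : ℝ, (∀ k, a * α k + b * β k = 0) → a = 0 ∧ b = 0 := by
  let φ : (Fin 6 → ℝ) →ₗ[ℝ] ℝ × E3 :=
    (∑ i, LinearMap.proj i).prod (∑ i, (LinearMap.proj i).smulRight (s i))
  have hφ : ∀ γ, φ γ = (∑ i, γ i, ∑ i, γ i • s i) := by
    intro γ; simp [φ]
  have hd : 2 ≤ Module.finrank ℝ (LinearMap.ker φ) := by
    have h1 := φ.finrank_range_add_finrank_ker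
    have h2 : Module.finrank ℝ (LinearMap.range φ) ≤ Module.finrank ℝ (ℝ × E3) :=
      Submodule.finrank_le _
    simp at h1 h2
    omega
  obtain ⟨v, hv⟩ := exists_linearIndependent_of_le_finrank hd
  have hdep : ∀ k, Dep s (v k : Fin 6 → ℝ) := by
    intro k
    have := (v k).2
    rw [LinearMap.mem_ker, hφ, Prod.mk_eq_zero] at this
    exact this
  refine ⟨v 0, v 1, hdep 0, hdep 1, ?_⟩
  intro a b h
  have := Fintype.linearIndependent_iff.1 hv ![a, b] (by
    rw [Fin.sum_univ_two]
    ext k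
    simpa using h k)
  exact ⟨this 0, this 1⟩

lemma good_of_gen (s : Fin 6 → E3) (hs : Gen s) : Good s := by
  obtain ⟨α, β, hα, hβ, hind⟩ := exists_deps s
  apply good_of_dep s α β hα hβ
  intro i j hij hn
  unfold nn at hn
  have h1 := gen_dep hs (dep_comb hα hβ (β i) (-α i)) hij (by ring) (by linarith)
  have h2 := hind _ _ (fun k => congrFun h1 k)
  have hai : α i = 0 := by linarith [h2.2]
  have h3 := gen_dep hs (dep_comb hα hβ (β j) (-α j)) hij (by rw [h2.1, hai]; ring) (by ring)
  have h4 := hind _ _ (fun k => congrFun h3 k)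
  have h5 := gen_dep hs hα hij hai (by linarith [h4.2])
  have h6 := hind 1 0 (fun k => by rw [h5]; simp)
  exact one_ne_zero h6.1

/-- Points on the moment curve. -/
noncomputable def mc (i : Fin 6) : E3 := !₂[(i : ℝ), (i : ℝ) ^ 2, (i : ℝ) ^ 3]

lemma mc_det (f : Fin 4 → Fin 6) (hf : Function.Injective f) : (MM mc f).det ≠ 0 := by
  have : MM mc f = Matrix.vandermonde (fun k => ((f k : ℕ) : ℝ)) := by
    ext i j
    rw [Matrix.vandermonde_apply]
    fin_cases j <;> simp [MM, mc]
  rw [this, Matrix.det_vandermonde_ne_zero_iff]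
  intro a b hab
  apply hf
  simp only at hab
  exact Fin.ext (by exact_mod_cast hab)

lemma gen_dense (s : Fin 6 → E3) : s ∈ closure {s | Gen s} := by
  let g : ℝ → Fin 6 → E3 := fun e i => (1 - e) • s i + e • mc i
  have hpoly : ∀ f : Fin 4 → Fin 6, ∃ p : Polynomial ℝ, ∀ e, p.eval e = (MM (g e) f).det := by
    intro f
    let P : Matrix (Fin 4) (Fin 4) (Polynomial ℝ) := Matrix.of fun i j =>
      (1 - Polynomial.X) * Polynomial.C (MM s f i j) + Polynomial.X * Polynomial.C (MM mc f i j)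
    refine ⟨P.det, fun e => ?_⟩
    have : (Polynomial.evalRingHom e) P.det = _ := RingHom.map_det _ _
    rw [Polynomial.coe_evalRingHom] at this
    rw [this]
    congr 1
    ext i j
    fin_cases j <;> simp [P, MM, g] <;> ring
  choose p hp using hpoly
  have hne : ∀ f, Function.Injective f → p f ≠ 0 := by
    intro f hf h
    have := hp f 1
    rw [h] at this
    have hg : g 1 = mc := by funext i; simp [g]
    rw [hg] at this
    exact mc_det f hf (by simpa using this.symm)
  have hev : ∀ᶠ e in nhdsWithin (0 : ℝ) {0}ᶜ, g e ∈ {s | Gen s} := by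
    have : ∀ f : Fin 4 → Fin 6, ∀ᶠ e in nhdsWithin (0 : ℝ) {0}ᶜ, Function.Injective f →
        (MM (g e) f).det ≠ 0 := by
      intro f
      by_cases hf : Function.Injective f
      · have hfin : ((p f).roots.toFinset : Set ℝ).Finite := Finset.finite_toSet _
        have h1 : ∀ᶠ e in nhdsWithin (0 : ℝ) {0}ᶜ, e ∉ ((p f).roots.toFinset : Set ℝ) := by
          have h2 : (((p f).roots.toFinset : Set ℝ) \ {0})ᶜ ∈ nhds (0 : ℝ) :=
            (hfin.subset Set.sdiff_subset).isClosed.isOpen_compl.mem_nhds (by simp)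
          filter_upwards [nhdsWithin_le_nhds h2, self_mem_nhdsWithin] with e h3 h4 h5
          exact h3 ⟨h5, h4⟩
        filter_upwards [h1] with e he _ hz
        apply he
        simp only [Finset.mem_coe, Multiset.mem_toFinset, Polynomial.mem_roots (hne f hf)]
        rw [Polynomial.IsRoot, hp, hz]
      · exact Filter.Eventually.of_forall fun e h => absurd h hf
    have := Filter.eventually_all.2 this
    filter_upwards [this] with e he f hf using he f hf
  have hcont : Continuous g := by fun_prop
  have hg0 : g 0 = s := by funext i; simp [g]
  have ht : Filter.Tendsto g (nhdsWithin (0 : ℝ) {0}ᶜ) (nhds s) := by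
    have := hcont.tendsto 0
    rw [hg0] at this
    exact this.mono_left nhdsWithin_le_nhds
  exact mem_closure_of_tendsto ht hev

lemma cov_closed (f : Fin 6 → Fin 6) (l : List (Fin 6 × Fin 6)) :
    IsClosed {s : Fin 6 → E3 | Cov s (s ∘ f) l} := by
  unfold Cov
  simp only [Set.ofPred_forall]
  refine isClosed_iInter fun c => isClosed_iInter fun hc => ?_
  have e : {s : Fin 6 → E3 | ∃ p ∈ l, ∃ m ∈ stdSimplex ℝ (Fin 4), ∑ k, c k • s k =
      m 0 • (s ∘ f) 0 + m 1 • (s ∘ f) 1 + m 2 • (s ∘ f) p.1 + m 3 • (s ∘ f) p.2} =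
    ⋃ p ∈ {p | p ∈ l}, {s : Fin 6 → E3 | ∃ m ∈ stdSimplex ℝ (Fin 4), ∑ k, c k • s k =
      m 0 • (s ∘ f) 0 + m 1 • (s ∘ f) 1 + m 2 • (s ∘ f) p.1 + m 3 • (s ∘ f) p.2} := by
    ext s; simp
  rw [e]
  refine (List.finite_toSet l).isClosed_biUnion fun p _ => ?_
  have : CompactSpace (stdSimplex ℝ (Fin 4)) := isCompact_iff_compactSpace.1
    (isCompact_stdSimplex ℝ (Fin 4))
  have hcl : IsClosed {q : stdSimplex ℝ (Fin 4) × (Fin 6 → E3) | ∑ k, c k • q.2 k =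
      (q.1 : Fin 4 → ℝ) 0 • (q.2 ∘ f) 0 + (q.1 : Fin 4 → ℝ) 1 • (q.2 ∘ f) 1 +
      (q.1 : Fin 4 → ℝ) 2 • (q.2 ∘ f) p.1 + (q.1 : Fin 4 → ℝ) 3 • (q.2 ∘ f) p.2} := by
    simp only [Function.comp]
    have hm : ∀ i : Fin 4, Continuous fun q : stdSimplex ℝ (Fin 4) × (Fin 6 → E3) =>
      (q.1 : Fin 4 → ℝ) i := fun i => (continuous_apply i).comp
        (continuous_subtype_val.comp continuous_fst)
    have hs : ∀ i : Fin 6, Continuous fun q : stdSimplex ℝ (Fin 4) × (Fin 6 → E3) => q.2 i :=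
      fun i => (continuous_apply i).comp continuous_snd
    refine isClosed_eq ?_ ?_
    · exact continuous_finsetSum _ fun i _ => by have := hs i; fun_prop
    · exact ((((hm 0).smul (hs _)).add ((hm 1).smul (hs _))).add ((hm 2).smul (hs _))).add
        ((hm 3).smul (hs _))
  have := isClosedMap_snd_of_compactSpace _ hcl
  convert this using 1
  ext s
  constructor
  · rintro ⟨m, hm, h⟩
    exact ⟨(⟨m, hm⟩, s), h, rfl⟩
  · rintro ⟨⟨m, s'⟩, h, rfl⟩
    exact ⟨m.1, m.2, h⟩

lemma sign_closed (f : Fin 6 → Fin 6) (l : List (Fin 6 × Fin 6)) :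
    IsClosed {s : Fin 6 → E3 | SameSign (s ∘ f) l} := by
  have hc : ∀ i j, Continuous fun s : Fin 6 → E3 => Tri (s ∘ f) i j := by
    intro i j
    unfold Tri trip
    simp only [Function.comp, PiLp.sub_apply]
    fun_prop
  unfold SameSign
  have e : {s : Fin 6 → E3 | (∀ p ∈ l, 0 ≤ Tri (s ∘ f) p.1 p.2) ∨
      (∀ p ∈ l, Tri (s ∘ f) p.1 p.2 ≤ 0)} = {s | ∀ p ∈ l, 0 ≤ Tri (s ∘ f) p.1 p.2} ∪
      {s | ∀ p ∈ l, Tri (s ∘ f) p.1 p.2 ≤ 0} := rfl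
  rw [e]
  simp only [Set.ofPred_forall]
  exact (isClosed_iInter fun p => isClosed_iInter fun _ =>
    isClosed_le continuous_const (hc _ _)).union (isClosed_iInter fun p => isClosed_iInter fun _ =>
    isClosed_le (hc _ _) continuous_const)

theorem good_all (s : Fin 6 → E3) : Good s := by
  have hcl : IsClosed {s : Fin 6 → E3 | Good s} := by
    have e : {s : Fin 6 → E3 | Good s} = ⋃ f : Fin 6 → Fin 6, ⋃ k : Fin 5,
        {s | Cov s (s ∘ f) (T k)} ∩ {s | SameSign (s ∘ f) (T k)} := by
      ext s
      simp [Good]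
    rw [e]
    exact isClosed_iUnion_of_finite fun f => isClosed_iUnion_of_finite fun k =>
      (cov_closed f _).inter (sign_closed f _)
  have h1 : {s : Fin 6 → E3 | Gen s} ⊆ {s | Good s} := fun s hs => good_of_gen s hs
  exact (hcl.closure_subset_iff.2 h1) (gen_dense s)

lemma half_vol (B : Set (Fin 3 → ℝ)) (hB : MeasurableSet B) (i : Fin 3)
    (hsym : ∀ x : Fin 3 → ℝ, Function.update x i (-x i) ∈ B ↔ x ∈ B) :
    volume B = 2 * volume (B ∩ {x | 0 ≤ x i}) := by
  let R : (Fin 3 → ℝ) → (Fin 3 → ℝ) := fun x j => (if j = i then (fun y : ℝ => -y) else id) (x j)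
  have hR : MeasurePreserving R volume volume := by
    apply volume_preserving_pi (f := fun j : Fin 3 => (if j = i then (fun y : ℝ => -y) else id))
    intro j
    split_ifs
    · exact Measure.measurePreserving_neg volume
    · exact MeasurePreserving.id _
  have hRu : ∀ x, R x = Function.update x i (-x i) := by
    intro x
    funext j
    by_cases h : j = i
    · subst h; simp [R]
    · simp [R, h]
  have hm : MeasurableSet {x : Fin 3 → ℝ | 0 ≤ x i} :=
    measurableSet_le measurable_const (measurable_pi_apply i)
  have h1 := measure_inter_add_sdiff (μ := volume) B hm
  have h2 : volume (B \ {x | 0 ≤ x i}) = volume (B ∩ {x | 0 ≤ x i}) := by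
    have hpre : R ⁻¹' (B ∩ {x | 0 ≤ x i}) = B ∩ {x | x i ≤ 0} := by
      ext x
      simp only [Set.mem_preimage, Set.mem_inter_iff, hRu, hsym]
      simp
    have h3 := hR.measure_preimage (hB.inter hm).nullMeasurableSet
    rw [hpre] at h3
    rw [← h3]
    apply le_antisymm
    · apply measure_mono
      rintro x ⟨hx, hx'⟩
      have : ¬ (0 ≤ x i) := hx'
      exact ⟨hx, (not_le.1 this).le⟩
    · have hz : volume {x : Fin 3 → ℝ | x i = 0} = 0 := Measure.pi_hyperplane _ i 0
      calc volume (B ∩ {x | x i ≤ 0}) ≤ volume ((B \ {x | 0 ≤ x i}) ∪ {x | x i = 0}) := by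
            apply measure_mono
            rintro x ⟨hx, hx'⟩
            have hx'' : x i ≤ 0 := hx'
            rcases hx''.eq_or_lt with h | h
            · exact Or.inr h
            · exact Or.inl ⟨hx, fun h' : 0 ≤ x i => absurd h (not_lt.2 h')⟩
        _ ≤ volume (B \ {x | 0 ≤ x i}) + 0 := by rw [← hz]; exact measure_union_le _ _
        _ = _ := add_zero _
  rw [h2] at h1
  rw [← h1, two_mul]

lemma vol_std : volume {x : Fin 3 → ℝ | (∀ i, 0 ≤ x i) ∧ ∑ i, x i ≤ 1} = ENNReal.ofReal (1 / 6) := by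
  have h := volume_sum_rpow_le (ι := Fin 3) (p := 1) le_rfl 1
  let B : Set (Fin 3 → ℝ) := {x | |x 0| + |x 1| + |x 2| ≤ 1}
  have hB : MeasurableSet B := measurableSet_le (by fun_prop) measurable_const
  have hm : ∀ i : Fin 3, MeasurableSet {x : Fin 3 → ℝ | 0 ≤ x i} := fun i =>
    measurableSet_le measurable_const (measurable_pi_apply i)
  have hBv : volume B = ENNReal.ofReal (8 / 6) := by
    have e : B = {x : Fin 3 → ℝ | (∑ i, |x i| ^ (1 : ℝ)) ^ (1 / (1 : ℝ)) ≤ 1} := by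
      ext x; simp [B, Fin.sum_univ_three]
    rw [e, h]
    have g : Real.Gamma (3 + 1) = 6 := by
      rw [show (3 : ℝ) + 1 = ((3 : ℕ) : ℝ) + 1 by norm_num, Real.Gamma_nat_eq_factorial]
      norm_num [Nat.factorial]
    have g2 : Real.Gamma (1 + 1) = 1 := by
      rw [show (1 : ℝ) + 1 = 2 by norm_num, Real.Gamma_two]
    simp [g, g2]
    norm_num
  have h0 := half_vol B hB 0 (by intro x; simp [B])
  have h1 := half_vol (B ∩ {x | 0 ≤ x 0}) (hB.inter (hm 0)) 1 (by intro x; simp [B])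
  have h2 := half_vol (B ∩ {x | 0 ≤ x 0} ∩ {x | 0 ≤ x 1}) ((hB.inter (hm 0)).inter (hm 1)) 2
    (by intro x; simp [B])
  have e : {x : Fin 3 → ℝ | (∀ i, 0 ≤ x i) ∧ ∑ i, x i ≤ 1} =
      B ∩ {x | 0 ≤ x 0} ∩ {x | 0 ≤ x 1} ∩ {x | 0 ≤ x 2} := by
    ext x
    simp only [B, Set.mem_inter_iff, Set.mem_ofPred_eq, Fin.forall_fin_succ, Fin.sum_univ_three]
    constructor
    · rintro ⟨⟨a, b, c, _⟩, d⟩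
      have a' : 0 ≤ x 0 := a
      have b' : 0 ≤ x 1 := b
      have c' : 0 ≤ x 2 := c
      refine ⟨⟨⟨?_, a'⟩, b'⟩, c'⟩
      rw [abs_of_nonneg a', abs_of_nonneg b', abs_of_nonneg c']; exact d
    · rintro ⟨⟨⟨d, a⟩, b⟩, c⟩
      rw [abs_of_nonneg a, abs_of_nonneg b, abs_of_nonneg c] at d
      exact ⟨⟨a, b, c, fun i => i.elim0⟩, d⟩
  rw [e]
  rw [h0, h1, h2] at hBv
  generalize volume (B ∩ {x | 0 ≤ x 0} ∩ {x | 0 ≤ x 1} ∩ {x | 0 ≤ x 2}) = V at *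
  have e8 : ENNReal.ofReal (8 / 6) = 8 * ENNReal.ofReal (1 / 6) := by
    rw [show (8 / 6 : ℝ) = 8 * (1 / 6) by norm_num, ENNReal.ofReal_mul (by norm_num)]
    norm_num
  rw [e8, ← mul_assoc, ← mul_assoc] at hBv
  norm_num at hBv
  have := (ENNReal.mul_right_inj (a := 8) (by norm_num) (by norm_num)).1 hBv
  simpa using this

/-- The tetrahedron with vertices `o, o+u, o+v, o+w`. -/
def tet (o u v w : E3) : Set E3 :=
  {x | ∃ a b c : ℝ, 0 ≤ a ∧ 0 ≤ b ∧ 0 ≤ c ∧ a + b + c ≤ 1 ∧ x = o + (a • u + b • v + c • w)}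

lemma vol_tet (o u v w : E3) : volume (tet o u v w) = ENNReal.ofReal (|trip u v w| / 6) := by
  let M : Matrix (Fin 3) (Fin 3) ℝ := !![u 0, v 0, w 0; u 1, v 1, w 1; u 2, v 2, w 2]
  have hdet : M.det = trip u v w := by
    rw [Matrix.det_fin_three]; simp [M, trip]; ring
  let S : Set (Fin 3 → ℝ) := {x | (∀ i, 0 ≤ x i) ∧ ∑ i, x i ≤ 1}
  have hmp := EuclideanSpace.volume_preserving_symm_measurableEquiv_toLp (Fin 3)
  have hset : tet o u v w = (fun x => o + x) '' ((MeasurableEquiv.toLp 2 (Fin 3 → ℝ)) '' (Matrix.toLin' M '' S)) := by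
    ext x
    constructor
    · rintro ⟨a, b, c, ha, hb, hc, hs, rfl⟩
      refine ⟨_, ⟨_, ⟨![a, b, c], ⟨?_, ?_⟩, rfl⟩, rfl⟩, ?_⟩
      · intro i; fin_cases i <;> assumption
      · simpa [Fin.sum_univ_three] using hs
      · simp only
        congr 1
        ext i
        fin_cases i <;> simp [M] <;> ring
    · rintro ⟨_, ⟨_, ⟨y, ⟨hy, hy'⟩, rfl⟩, rfl⟩, rfl⟩
      rw [Fin.sum_univ_three] at hy'
      refine ⟨y 0, y 1, y 2, hy 0, hy 1, hy 2, hy', ?_⟩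
      simp only
      congr 1
      ext i
      fin_cases i <;> simp [M, Matrix.vecHead, Matrix.vecTail] <;> ring
  rw [hset, Set.image_add_left, measure_preimage_add]
  have h2 : volume ((MeasurableEquiv.toLp 2 (Fin 3 → ℝ)) '' (Matrix.toLin' M '' S)) =
      volume (Matrix.toLin' M '' S) := by
    rw [MeasurableEquiv.image_eq_preimage_symm]
    exact hmp.measure_preimage_equiv _
  rw [h2, Measure.addHaar_image_linearMap, vol_std, LinearMap.det_toLin', hdet,
    ← ENNReal.ofReal_mul (abs_nonneg _)]
  congr 1
  ring

lemma trip_gram (a b c : E3) : trip a b c ^ 2 =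
    inner ℝ a a * (inner ℝ b b * inner ℝ c c - inner ℝ b c ^ 2)
    - inner ℝ a b * (inner ℝ a b * inner ℝ c c - inner ℝ b c * inner ℝ a c)
    + inner ℝ a c * (inner ℝ a b * inner ℝ b c - inner ℝ b b * inner ℝ a c) := by
  simp only [PiLp.inner_apply, Fin.sum_univ_three, trip]
  simp
  ring

/-- Linear isometries change the triple product by a sign. -/
lemma trip_isom (L : E3 ≃ₗᵢ[ℝ] E3) : ∃ e : ℝ, (e = 1 ∨ e = -1) ∧
    ∀ u v w, trip u v w = e * trip (L u) (L v) (L w) := by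
  let b := EuclideanSpace.basisFun (Fin 3) ℝ
  have hexp : ∀ u, L u = u 0 • L (b 0) + u 1 • L (b 1) + u 2 • L (b 2) := by
    intro u
    have : u = u 0 • b 0 + u 1 • b 1 + u 2 • b 2 := by
      ext i; fin_cases i <;> simp [b]
    conv_lhs => rw [this]
    simp only [map_add, map_smul]
  have hin : ∀ i j, inner ℝ (L (b i)) (L (b j)) = if i = j then (1 : ℝ) else 0 := by
    intro i j
    rw [L.inner_map_map]
    exact orthonormal_iff_ite.1 b.orthonormal i j
  have hsq : trip (L (b 0)) (L (b 1)) (L (b 2)) ^ 2 = 1 := by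
    rw [trip_gram]; simp [hin]
  have hmul : ∀ u v w, trip (L u) (L v) (L w) =
      trip (L (b 0)) (L (b 1)) (L (b 2)) * trip u v w := by
    intro u v w
    rw [hexp u, hexp v, hexp w]
    simp only [trip, PiLp.add_apply, PiLp.smul_apply, smul_eq_mul]
    ring
  refine ⟨trip (L (b 0)) (L (b 1)) (L (b 2)), ?_, ?_⟩
  · have : (trip (L (b 0)) (L (b 1)) (L (b 2)) - 1) * (trip (L (b 0)) (L (b 1)) (L (b 2)) + 1) = 0 := by
      linear_combination hsq
    rcases mul_eq_zero.1 this with h | h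
    · left; linarith
    · right; linarith
  · intro u v w
    rw [hmul u v w, ← mul_assoc, ← sq, hsq, one_mul]

lemma exists_isom (d e : E3) : ∃ L : E3 ≃ₗᵢ[ℝ] E3, (L d) 1 = 0 ∧ (L d) 2 = 0 ∧ (L e) 2 = 0 := by
  have hfr : Module.finrank ℝ E3 = Fintype.card (Fin 3) := by simp
  let f : Fin 3 → E3 := ![d, e, 0]
  let b := InnerProductSpace.gramSchmidtOrthonormalBasis hfr f
  have h : ∀ i j : Fin 3, i < j → (b.repr (f i)) j = 0 := by
    intro i j hij
    exact InnerProductSpace.gramSchmidtOrthonormalBasis_inv_triangular' hfr f hij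
  exact ⟨b.repr, h 0 1 (by decide), h 0 2 (by decide), h 1 2 (by decide)⟩

lemma cross_le (t x y x' y' : ℝ) (ht : t ^ 2 ≤ 1) (h : x ^ 2 + y ^ 2 ≤ 1) (h' : x' ^ 2 + y' ^ 2 ≤ 1) :
    |t * (x * y' - y * x')| ≤ 1 := by
  rw [← sq_le_one_iff_abs_le_one, mul_pow]
  have h1 : (x * y' - y * x') ^ 2 ≤ 1 := by
    have h2 : (x ^ 2 + y ^ 2) * (x' ^ 2 + y' ^ 2) ≤ 1 := mul_le_one₀ h (by positivity) h'
    nlinarith only [h2, sq_nonneg (x * x' + y * y')]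
  exact mul_le_one₀ ht (by positivity) h1

lemma dist_coord {u v : E3} (h : dist u v ≤ 1) :
    (u 0 - v 0) ^ 2 + (u 1 - v 1) ^ 2 + (u 2 - v 2) ^ 2 ≤ 1 := by
  rw [EuclideanSpace.dist_eq, Real.sqrt_le_iff, Fin.sum_univ_three] at h
  replace h := h.2
  simpa [Real.dist_eq, sq_abs] using h

lemma sum_abs_same {ι : Type*} (F : ι → ℝ) (l : List ι)
    (h : (∀ p ∈ l, 0 ≤ F p) ∨ (∀ p ∈ l, F p ≤ 0)) :
    (l.map fun p => |F p|).sum = |(l.map F).sum| := by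
  rcases h with h | h
  · rw [abs_of_nonneg (List.sum_nonneg (by simpa using h))]
    congr 1
    exact List.map_congr_left fun p hp => abs_of_nonneg (h p hp)
  · have e : (l.map fun p => |F p|) = l.map (fun p => - F p) :=
      List.map_congr_left fun p hp => abs_of_nonpos (h p hp)
    have e2 : (l.map (fun p => - F p)).sum = - (l.map F).sum := by
      clear h e
      induction l with
      | nil => simp
      | cons a l ih => simp [ih]; ring
    have h3 : (l.map F).sum ≤ 0 := by
      have : 0 ≤ (l.map (fun p => - F p)).sum := List.sum_nonneg (by simpa using h)
      rw [e2] at this; linarith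
    rw [e, e2, abs_of_nonpos h3]

lemma sum_bound (g : Fin 6 → E3) (hd : ∀ i j, dist (g i) (g j) ≤ 1) (B : ℝ) (hB : GoodB B)
    (k : Fin 5) (hs : SameSign g (T k)) :
    ((T k).map fun p => |Tri g p.1 p.2|).sum ≤ B := by
  rw [sum_abs_same (fun p : Fin 6 × Fin 6 => Tri g p.1 p.2) (T k) hs]
  obtain ⟨L, hL1, hL2, hL3⟩ := exists_isom (g 1 - g 0) (g 4 - g 3)
  obtain ⟨e, he, htrip⟩ := trip_isom L
  have hB1 : 1 ≤ B := by have := hB.1; linarith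
  obtain ⟨h, hh⟩ : ∃ h : Fin 6 → E3, h = fun i => L (g i - g 0) := ⟨_, rfl⟩
  have h10 : h 1 1 = 0 := by rw [hh]; exact hL1
  have h12 : h 1 2 = 0 := by rw [hh]; exact hL2
  have h0 : h 0 = 0 := by rw [hh]; simp
  have hq : h 4 2 = h 3 2 := by
    have e1 : h 4 - h 3 = L (g 4 - g 3) := by
      rw [hh]; simp only [← map_sub]; congr 1; abel
    have := congrArg (fun v : E3 => v 2) e1
    simp only [PiLp.sub_apply, hL3] at this
    linarith
  have hdist : ∀ i j, (h i 0 - h j 0) ^ 2 + (h i 1 - h j 1) ^ 2 + (h i 2 - h j 2) ^ 2 ≤ 1 := by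
    intro i j
    apply dist_coord
    rw [hh]
    simp only
    rw [L.dist_map, dist_sub_right]
    exact hd i j
  have htri : ∀ x y, Tri g x y = e * (h 1 0 * (h x 1 * h y 2 - h x 2 * h y 1)) := by
    intro x y
    have e1 : ∀ i, L (g i - g 0) = h i := by intro i; rw [hh]
    rw [Tri, htrip, e1, e1, e1, trip, h10, h12]
    ring
  have hz0 : ∀ c, h 0 c = 0 := by intro c; rw [h0]; rfl
  have hpl0 : ∀ i, (h i 1) ^ 2 + (h i 2) ^ 2 ≤ 1 := by
    intro i
    have := hdist i 0
    rw [hz0, hz0, hz0, sub_zero, sub_zero, sub_zero] at this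
    nlinarith only [this, sq_nonneg (h i 0)]
  have hpl : ∀ i j, (h i 1 - h j 1) ^ 2 + (h i 2 - h j 2) ^ 2 ≤ 1 := by
    intro i j
    nlinarith only [hdist i j, sq_nonneg (h i 0 - h j 0)]
  have ht : (h 1 0) ^ 2 ≤ 1 := by
    have := hdist 1 0
    rw [hz0, hz0, hz0, h10, h12] at this
    linarith
  have heabs : ∀ x : ℝ, |e * x| = |x| := by
    intro x; rcases he with rfl | rfl <;> simp
  fin_cases k
  · simp only [T]
    have := cross_le (h 1 0) _ _ _ _ ht (hpl0 2) (hpl0 3)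
    simp only [htri]
    simp [heabs]
    simp at this
    linarith
  · have := cross_le (h 1 0) _ _ _ _ ht (hpl 2 4) (hpl0 3)
    refine le_trans (le_of_eq ?_) (this.trans hB1)
    simp [T, htri, -abs_mul]
    rw [← mul_add, heabs]
    congr 1
    ring
  · have := cross_le (h 1 0) _ _ _ _ ht (hpl 3 2) (hpl 4 2)
    refine le_trans (le_of_eq ?_) (this.trans hB1)
    simp [T, htri, -abs_mul]
    rw [← mul_add, ← mul_add, heabs]
    congr 1
    ring
  · have := cross_le (h 1 0) _ _ _ _ ht (hpl 4 2) (hpl 5 3)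
    refine le_trans (le_of_eq ?_) (this.trans hB1)
    simp [T, htri, -abs_mul]
    rw [← mul_add, ← mul_add, ← mul_add, heabs]
    congr 1
    ring
  · have d3 := hdist 3 0
    have d3' := hdist 3 1
    have d4 := hdist 4 0
    have d4' := hdist 4 1
    have d24 := hpl 2 4
    have d35 := hpl 3 5
    have d25 := hpl 2 5
    have d34 := hpl 3 4
    simp only [hz0, h10, h12, sub_zero, hq, sub_self] at d3 d3' d4 d4' d24 d35 d25 d34
    have hs' : (0 ≤ h 1 0 * (h 2 1 * h 3 2 - h 2 2 * h 3 1) ∧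
        0 ≤ h 1 0 * (h 3 1 * h 3 2 - h 3 2 * h 4 1) ∧
        0 ≤ h 1 0 * (h 4 1 * h 5 2 - h 3 2 * h 5 1)) ∨
        (h 1 0 * (h 2 1 * h 3 2 - h 2 2 * h 3 1) ≤ 0 ∧
        h 1 0 * (h 3 1 * h 3 2 - h 3 2 * h 4 1) ≤ 0 ∧
        h 1 0 * (h 4 1 * h 5 2 - h 3 2 * h 5 1) ≤ 0) := by
      unfold SameSign at hs
      simp only [htri] at hs
      simp [T, hq] at hs
      rcases he with rfl | rfl
      · simpa using hs
      · simp only [neg_mul, one_mul, neg_nonneg, neg_nonpos] at hs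
        tauto
    have := path_bound B (h 1 0) (h 3 0) (h 4 0) (h 2 1) (h 3 1) (h 4 1) (h 5 1) (h 2 2) (h 3 2)
      (h 5 2) hB ht d3 d3' d4 d4' d24 d35 d25 (by linarith) hs'
    refine le_trans (le_of_eq ?_) this
    simp [T, htri, -abs_mul]
    rw [← mul_add, ← mul_add, heabs, hq]
    congr 1
    ring

lemma hull_vol (s : Fin 6 → E3) (hd : ∀ i j, dist (s i) (s j) ≤ 1) (B : ℝ) (hB : GoodB B) :
    volume (convexHull ℝ (Set.range s)) ≤ ENNReal.ofReal (B / 6) := by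
  obtain ⟨f, k, hc, hs⟩ := good_all s
  have hsub : convexHull ℝ (Set.range s) ⊆ ⋃ p ∈ (T k).toFinset,
      tet (s (f 0)) (s (f 1) - s (f 0)) (s (f p.1) - s (f 0)) (s (f p.2) - s (f 0)) := by
    intro x hx
    have hx' : ∃ c ∈ stdSimplex ℝ (Fin 6), ∑ i, c i • s i = x := by
      have e : convexHull ℝ (Set.range s) =
          (⇑(∑ i, (LinearMap.proj (R := ℝ) (φ := fun _ : Fin 6 => ℝ) i).smulRight (s i))) ''
            stdSimplex ℝ (Fin 6) := by
        rw [← convexHull_basis_eq_stdSimplex, LinearMap.image_convexHull, ← Set.range_comp]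
        apply congr_arg
        congr 1
        funext i
        simp
      rw [e] at hx
      obtain ⟨c, hc, rfl⟩ := hx
      exact ⟨c, hc, by simp⟩
    obtain ⟨c, hcs, rfl⟩ := hx'
    obtain ⟨p, hp, m, hm, he⟩ := hc c hcs
    rw [he]
    simp only [Set.mem_iUnion]
    refine ⟨p, by simpa using hp, m 1, m 2, m 3, hm.1 _, hm.1 _, hm.1 _, ?_, ?_⟩
    · have := hm.2
      rw [Fin.sum_univ_four] at this
      have := hm.1 0
      linarith
    · have h0 : m 0 = 1 - m 1 - m 2 - m 3 := by
        have := hm.2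
        rw [Fin.sum_univ_four] at this
        linarith
      rw [h0]
      simp only [Function.comp]
      module
  calc volume (convexHull ℝ (Set.range s)) ≤ _ := measure_mono hsub
    _ ≤ ∑ p ∈ (T k).toFinset, volume (tet (s (f 0)) (s (f 1) - s (f 0)) (s (f p.1) - s (f 0))
        (s (f p.2) - s (f 0))) := measure_biUnion_finset_le _ _
    _ = ∑ p ∈ (T k).toFinset, ENNReal.ofReal (|Tri (s ∘ f) p.1 p.2| / 6) := by
        refine Finset.sum_congr rfl fun p _ => ?_
        rw [vol_tet]; rfl
    _ = ENNReal.ofReal (∑ p ∈ (T k).toFinset, |Tri (s ∘ f) p.1 p.2| / 6) := by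
        rw [ENNReal.ofReal_sum_of_nonneg]
        intros; positivity
    _ ≤ ENNReal.ofReal (B / 6) := by
        apply ENNReal.ofReal_le_ofReal
        have hnd : (T k).Nodup := by clear hsub hs hc; revert k; decide
        rw [← Finset.sum_div, List.sum_toFinset _ hnd]
        have := sum_bound (s ∘ f) (fun i j => hd _ _) B hB k hs
        linarith

lemma upper (S : Finset E3) (hS : S.card = 6) (hd : Metric.diam (S : Set E3) ≤ 1) (B : ℝ)
    (hB : GoodB B) : (volume (convexHull ℝ (S : Set E3))).toReal ≤ B / 6 := by
  let e := S.equivFinOfCardEq hS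
  let s : Fin 6 → E3 := fun i => (e.symm i : E3)
  have hr : Set.range s = (S : Set E3) := by
    ext x
    constructor
    · rintro ⟨i, rfl⟩; exact (e.symm i).2
    · intro hx; exact ⟨e ⟨x, hx⟩, by simp [s]⟩
  have hdist : ∀ i j, dist (s i) (s j) ≤ 1 := fun i j =>
    (Metric.dist_le_diam_of_mem S.finite_toSet.isBounded (e.symm i).2 (e.symm j).2).trans hd
  have := hull_vol s hdist B hB
  rw [hr] at this
  have hB6 : 0 ≤ B / 6 := by have := hB.1; linarith
  exact ENNReal.toReal_le_of_le_ofReal hB6 this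

lemma A_le_two {x : ℝ} (h0 : 0 ≤ x) (h1 : x ≤ 1 / 2) : A (Real.sqrt 3 / 2) x ≤ 2 := by
  have h := A_two x
  have e1 : Real.sqrt (3 / 4 - x - x ^ 2) ≤ 1 := by
    exact Real.sqrt_le_iff.2 ⟨by norm_num, by nlinarith⟩
  have e2 : Real.sqrt (3 / 4 - x ^ 2) ≤ 1 := by
    exact Real.sqrt_le_iff.2 ⟨by norm_num, by nlinarith⟩
  nlinarith [Real.sqrt_nonneg (3 / 4 - x - x ^ 2)]

lemma bdd_A : BddAbove (A (Real.sqrt 3 / 2) '' Set.Icc (0 : ℝ) (1 / 2)) := by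
  refine ⟨2, ?_⟩
  rintro _ ⟨x, hx, rfl⟩
  exact A_le_two hx.1 hx.2

lemma A_three : 293 / 500 ≤ A (Real.sqrt 3 / 2) (3 / 10) := by
  have h := A_two (3 / 10)
  have e1 : Real.sqrt (3 / 4 - 3 / 10 - (3 / 10) ^ 2) = 6 / 10 := by
    rw [show (3 / 4 - 3 / 10 - (3 / 10) ^ 2 : ℝ) = (6 / 10) ^ 2 by norm_num]
    exact Real.sqrt_sq (by norm_num)
  have e2 : 812 / 1000 ≤ Real.sqrt (3 / 4 - (3 / 10) ^ 2) := by
    apply Real.le_sqrt_of_sq_le; norm_num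
  rw [e1] at h
  linarith

lemma goodB : GoodB (2 * sSup (A (Real.sqrt 3 / 2) '' Set.Icc (0 : ℝ) (1 / 2))) := by
  constructor
  · have := le_csSup bdd_A ⟨3 / 10, ⟨by norm_num, by norm_num⟩, rfl⟩
    have := A_three
    linarith
  · intro x h0 h1
    have := le_csSup bdd_A ⟨x, ⟨h0, h1⟩, rfl⟩
    have := A_two x
    linarith

lemma vol_union_ge (f : E3 →ₗ[ℝ] ℝ) (hf : f ≠ 0) (U W : Set E3) (hU : ∀ x ∈ U, f x ≤ 0)
    (hW : ∀ x ∈ W, 0 ≤ f x) : volume U + volume W ≤ volume (U ∪ W) := by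
  have hz : volume {x : E3 | f x = 0} = 0 := by
    have h := Measure.addHaar_submodule (volume : Measure E3) (LinearMap.ker f)
      (by rw [Ne, LinearMap.ker_eq_top]; exact hf)
    exact h
  have hc : Continuous f := f.continuous_of_finiteDimensional
  have hm : MeasurableSet {x : E3 | f x ≤ 0} := measurableSet_le hc.measurable measurable_const
  rw [← measure_inter_add_sdiff (μ := volume) (U ∪ W) hm]
  apply add_le_add
  · exact measure_mono fun x hx => ⟨Or.inl hx, hU x hx⟩
  · calc volume W ≤ volume (((U ∪ W) \ {x : E3 | f x ≤ 0}) ∪ {x : E3 | f x = 0}) := by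
          apply measure_mono
          intro x hx
          rcases (hW x hx).eq_or_lt with h | h
          · exact Or.inr h.symm
          · exact Or.inl ⟨Or.inr hx, fun h' : f x ≤ 0 => absurd h (not_lt.2 h')⟩
      _ ≤ volume ((U ∪ W) \ {x : E3 | f x ≤ 0}) + 0 := by rw [← hz]; exact measure_union_le _ _
      _ = _ := add_zero _

lemma tet_subset {S : Set E3} {o u v w : E3} (h0 : o ∈ S) (h1 : o + u ∈ S) (h2 : o + v ∈ S)
    (h3 : o + w ∈ S) : tet o u v w ⊆ convexHull ℝ S := by
  rintro x ⟨a, b, c, ha, hb, hc, hs, rfl⟩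
  have hcv := convex_convexHull ℝ S
  have key := hcv.sum_mem (t := Finset.univ) (w := ![1 - a - b - c, a, b, c])
    (z := ![o, o + u, o + v, o + w])
    (by
      intro i _
      fin_cases i
      · show 0 ≤ 1 - a - b - c
        linarith
      · exact ha
      · exact hb
      · exact hc)
    (by simp [Fin.sum_univ_four]; ring)
    (by
      intro i _
      fin_cases i
      · exact subset_convexHull ℝ S h0
      · exact subset_convexHull ℝ S h1
      · exact subset_convexHull ℝ S h2
      · exact subset_convexHull ℝ S h3)
  rw [Fin.sum_univ_four] at key
  convert key using 1
  simp
  module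

/-- The linear functional `x ↦ p * x 0 + q * x 1`. -/
noncomputable def fnl (p q : ℝ) : E3 →ₗ[ℝ] ℝ where
  toFun x := p * x 0 + q * x 1
  map_add' x y := by simp; ring
  map_smul' c x := by simp; ring

lemma fnl_tet {p q r : ℝ} {o u v w : E3} (ho : fnl p q o = 0) (hu : fnl p q u = 0)
    (hv : 0 ≤ r * fnl p q v) (hw : 0 ≤ r * fnl p q w) :
    ∀ x ∈ tet o u v w, 0 ≤ r * fnl p q x := by
  rintro x ⟨a, b, c, ha, hb, hc, hs, rfl⟩
  simp only [map_add, map_smul, ho, hu, smul_eq_mul]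
  have := mul_nonneg hb hv
  have := mul_nonneg hc hw
  nlinarith

/-- The point with given coordinates. -/
noncomputable def pt (a b c : ℝ) : E3 := !₂[a, b, c]

lemma fnl_pt (p q a b c : ℝ) : fnl p q (pt a b c) = p * a + q * b := by
  simp [fnl, pt]

lemma pt_add (a b c a' b' c' : ℝ) : pt a b c + pt a' b' c' = pt (a + a') (b + b') (c + c') := by
  ext i; fin_cases i <;> simp [pt]

lemma pt_dist {a b c a' b' c' : ℝ} (h : (a - a') ^ 2 + (b - b') ^ 2 + (c - c') ^ 2 ≤ 1) :
    dist (pt a b c) (pt a' b' c') ≤ 1 := by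
  rw [EuclideanSpace.dist_eq]
  refine Real.sqrt_le_iff.2 ⟨by norm_num, ?_⟩
  simp [pt, Fin.sum_univ_three, Real.dist_eq]
  exact h

set_option maxHeartbeats 2000000 in
lemma lower {x : ℝ} (h0 : 0 < x) (h1 : x < 1 / 2) :
    ∃ S : Finset E3, S.card = 6 ∧ Metric.diam (S : Set E3) ≤ 1 ∧
      ENNReal.ofReal (A (Real.sqrt 3 / 2) x / 3) ≤ volume (convexHull ℝ (S : Set E3)) := by
  have hA := A_two x
  have hQ2 : Real.sqrt (3 / 4 - x ^ 2) ^ 2 = 3 / 4 - x ^ 2 := Real.sq_sqrt (by nlinarith)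
  have hh2 : Real.sqrt (3 / 4 - x - x ^ 2) ^ 2 = 3 / 4 - x - x ^ 2 := Real.sq_sqrt (by nlinarith)
  have hQ0 : 0 < Real.sqrt (3 / 4 - x ^ 2) := Real.sqrt_pos.2 (by nlinarith)
  have hh0 : 0 ≤ Real.sqrt (3 / 4 - x - x ^ 2) := Real.sqrt_nonneg _
  have hhQ : Real.sqrt (3 / 4 - x - x ^ 2) ≤ Real.sqrt (3 / 4 - x ^ 2) :=
    Real.sqrt_le_sqrt (by linarith)
  generalize Real.sqrt (3 / 4 - x ^ 2) = Q at *
  generalize Real.sqrt (3 / 4 - x - x ^ 2) = h at *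
  have hQh : (Q - h) ^ 2 ≤ 1 / 2 := by nlinarith
  let s : Fin 6 → E3 := ![pt 0 0 (-1 / 2), pt (-1 / 2) (h - Q) 0, pt (-x) (-Q) 0, pt x (-Q) 0,
    pt (1 / 2) (h - Q) 0, pt 0 0 (1 / 2)]
  have hinj : Function.Injective s := by
    have hm : StrictMono (fun i => (s i) 0 + 10 * (s i) 2) := by
      rw [Fin.strictMono_iff_lt_succ]
      intro i
      fin_cases i <;> simp [s, pt] <;> linarith
    intro i j hij
    apply hm.injective
    simp only [hij]
  have hd : ∀ i j, dist (s i) (s j) ≤ 1 := by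
    intro i j
    fin_cases i <;> fin_cases j <;> exact pt_dist (by nlinarith)
  let S : Finset E3 := Finset.univ.image s
  have hmem : ∀ i, s i ∈ (S : Set E3) := fun i => by simp [S]
  refine ⟨S, ?_, ?_, ?_⟩
  · rw [Finset.card_image_of_injective _ hinj]; simp
  · apply Metric.diam_le_of_forall_dist_le (by norm_num)
    intro p hp q hq
    simp only [S, Finset.coe_image, Set.mem_image] at hp hq
    obtain ⟨i, -, rfl⟩ := hp
    obtain ⟨j, -, rfl⟩ := hq
    exact hd i j
  · have k1 : 0 ≤ Q / 2 + x * h - x * Q := by nlinarith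
    have k2 : x * h ≤ x * Q := mul_le_mul_of_nonneg_left hhQ h0.le
    have k3 : 0 ≤ x * Q := by positivity
    have k4 : 0 ≤ x * h := by positivity
    let o := pt 0 0 (-1 / 2)
    let u := pt 0 0 1
    let c1 := pt (-1 / 2) (h - Q) (1 / 2)
    let c2 := pt (-x) (-Q) (1 / 2)
    let c3 := pt x (-Q) (1 / 2)
    let c4 := pt (1 / 2) (h - Q) (1 / 2)
    have m0 : o ∈ (S : Set E3) := hmem 0
    have mu : o + u ∈ (S : Set E3) := by
      have := hmem 5
      convert this using 1
      show o + u = pt 0 0 (1 / 2)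
      simp only [o, u, pt_add]; norm_num
    have m1 : o + c1 ∈ (S : Set E3) := by
      have := hmem 1
      convert this using 1
      show o + c1 = pt (-1 / 2) (h - Q) 0
      simp only [o, c1, pt_add]; norm_num
    have m2 : o + c2 ∈ (S : Set E3) := by
      have := hmem 2
      convert this using 1
      show o + c2 = pt (-x) (-Q) 0
      simp only [o, c2, pt_add]; norm_num
    have m3 : o + c3 ∈ (S : Set E3) := by
      have := hmem 3
      convert this using 1
      show o + c3 = pt x (-Q) 0
      simp only [o, c3, pt_add]; norm_num
    have m4 : o + c4 ∈ (S : Set E3) := by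
      have := hmem 4
      convert this using 1
      show o + c4 = pt (1 / 2) (h - Q) 0
      simp only [o, c4, pt_add]; norm_num
    have v1 : volume (tet o u c1 c2) = ENNReal.ofReal ((Q / 2 + x * h - x * Q) / 6) := by
      rw [vol_tet]
      congr 2
      rw [← abs_of_nonneg k1]
      congr 1
      simp [trip, o, u, c1, c2, pt]; ring
    have v2 : volume (tet o u c2 c3) = ENNReal.ofReal ((2 * (x * Q)) / 6) := by
      rw [vol_tet]
      congr 2
      rw [← abs_of_nonneg (show 0 ≤ 2 * (x * Q) by linarith)]
      congr 1
      simp [trip, o, u, c2, c3, pt]; ring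
    have v3 : volume (tet o u c3 c4) = ENNReal.ofReal ((Q / 2 + x * h - x * Q) / 6) := by
      rw [vol_tet]
      congr 2
      rw [← abs_of_nonneg k1]
      congr 1
      simp [trip, o, u, c3, c4, pt]; ring
    have f1 : fnl Q (-x) ≠ 0 := by
      intro hf
      have := fnl_pt Q (-x) 1 0 0
      rw [hf] at this
      simp at this
      linarith
    have f2 : fnl Q x ≠ 0 := by
      intro hf
      have := fnl_pt Q x 1 0 0
      rw [hf] at this
      simp at this
      linarith
    have z : ∀ p q c, fnl p q (pt 0 0 c) = 0 := by intro p q c; rw [fnl_pt]; ring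
    have t1 : ∀ y ∈ tet o u c1 c2, 0 ≤ -1 * fnl Q (-x) y :=
      fnl_tet (z _ _ _) (z _ _ _) (by rw [fnl_pt]; nlinarith) (by rw [fnl_pt]; nlinarith)
    have t2 : ∀ y ∈ tet o u c2 c3, 0 ≤ 1 * fnl Q (-x) y :=
      fnl_tet (z _ _ _) (z _ _ _) (by rw [fnl_pt]; nlinarith) (by rw [fnl_pt]; nlinarith)
    have t3 : ∀ y ∈ tet o u c1 c2, 0 ≤ -1 * fnl Q x y :=
      fnl_tet (z _ _ _) (z _ _ _) (by rw [fnl_pt]; nlinarith) (by rw [fnl_pt]; nlinarith)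
    have t4 : ∀ y ∈ tet o u c2 c3, 0 ≤ -1 * fnl Q x y :=
      fnl_tet (z _ _ _) (z _ _ _) (by rw [fnl_pt]; nlinarith) (by rw [fnl_pt]; nlinarith)
    have t5 : ∀ y ∈ tet o u c3 c4, 0 ≤ 1 * fnl Q x y :=
      fnl_tet (z _ _ _) (z _ _ _) (by rw [fnl_pt]; nlinarith) (by rw [fnl_pt]; nlinarith)
    have w1 := vol_union_ge (fnl Q (-x)) f1 (tet o u c1 c2) (tet o u c2 c3)
      (fun y hy => by linarith [t1 y hy]) (fun y hy => by linarith [t2 y hy])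
    have w2 := vol_union_ge (fnl Q x) f2 (tet o u c1 c2 ∪ tet o u c2 c3) (tet o u c3 c4)
      (fun y hy => by
        rcases hy with hy | hy
        · linarith [t3 y hy]
        · linarith [t4 y hy]) (fun y hy => by linarith [t5 y hy])
    calc ENNReal.ofReal (A (Real.sqrt 3 / 2) x / 3)
        = ENNReal.ofReal ((Q / 2 + x * h - x * Q) / 6 + (2 * (x * Q)) / 6
            + (Q / 2 + x * h - x * Q) / 6) := by
          congr 1; linarith
      _ = volume (tet o u c1 c2) + volume (tet o u c2 c3) + volume (tet o u c3 c4) := by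
          rw [v1, v2, v3, ← ENNReal.ofReal_add (by linarith) (by linarith),
            ← ENNReal.ofReal_add (by linarith) (by linarith)]
      _ ≤ volume (tet o u c1 c2 ∪ tet o u c2 c3) + volume (tet o u c3 c4) := by gcongr
      _ ≤ _ := w2
      _ ≤ _ := measure_mono (Set.union_subset (Set.union_subset (tet_subset m0 mu m1 m2)
          (tet_subset m0 mu m2 m3)) (tet_subset m0 mu m3 m4))

lemma bdd_V : BddAbove {v : ℝ | ∃ S : Finset E3,
    S.card = 6 ∧ Metric.diam (S : Set E3) ≤ 1 ∧ v = (volume (convexHull ℝ (S : Set E3))).toReal} := by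
  refine ⟨2 * sSup (A (Real.sqrt 3 / 2) '' Set.Icc (0 : ℝ) (1 / 2)) / 6, ?_⟩
  · rintro v ⟨S, hS, hd, rfl⟩
    exact upper S hS hd _ goodB

lemma A_le_V {x : ℝ} (h0 : 0 < x) (h1 : x < 1 / 2) :
    A (Real.sqrt 3 / 2) x / 3 ≤ polyVol 3 6 := by
  obtain ⟨S, hS, hd, hv⟩ := lower h0 h1
  refine le_trans ?_ (le_csSup bdd_V ⟨S, hS, hd, rfl⟩)
  refine (ENNReal.ofReal_le_iff_le_toReal ?_).1 hv
  exact (S.finite_toSet.isCompact_convexHull ℝ).measure_lt_top.ne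

lemma final :
    polyVol 3 6 =
      (1 / 3) * sSup (A (Real.sqrt 3 / 2) '' Set.Icc (0 : ℝ) (1 / 2)) := by
  apply le_antisymm
  · apply csSup_le
    · obtain ⟨S, hS, hd, -⟩ := lower (x := 3 / 10) (by norm_num) (by norm_num)
      exact ⟨_, S, hS, hd, rfl⟩
    · rintro v ⟨S, hS, hd, rfl⟩
      have := upper S hS hd _ goodB
      linarith
  · have : sSup (A (Real.sqrt 3 / 2) '' Set.Icc (0 : ℝ) (1 / 2)) ≤ 3 * polyVol 3 6 := by
      have h3 := A_le_V (x := 3 / 10) (by norm_num) (by norm_num)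
      have h4 := A_three
      refine csSup_le ⟨A (Real.sqrt 3 / 2) 0, 0, ⟨by norm_num, by norm_num⟩, rfl⟩ ?_
      rintro _ ⟨x, ⟨h0, h1⟩, rfl⟩
      rcases h0.eq_or_lt with rfl | h0
      · have h := A_two 0
        have : Real.sqrt (3 / 4 - 0 ^ 2) ≤ 9 / 10 :=
          Real.sqrt_le_iff.2 ⟨by norm_num, by norm_num⟩
        linarith
      rcases h1.eq_or_lt with rfl | h1
      · have h := A_two (1 / 2)
        have : Real.sqrt (3 / 4 - (1 / 2) ^ 2) ≤ 8 / 10 :=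
          Real.sqrt_le_iff.2 ⟨by norm_num, by norm_num⟩
        have : Real.sqrt (3 / 4 - 1 / 2 - (1 / 2) ^ 2) = 0 := by
          rw [Real.sqrt_eq_zero']; norm_num
        rw [this] at h
        linarith
      have := A_le_V h0 h1
      linarith
    linarith

theorem stmt_13 :
    polyVol 3 6 =
      (1 / 3) * sSup (A (Real.sqrt 3 / 2) '' Set.Icc (0 : ℝ) (1 / 2)) := by
  exact final
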